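/- arXiv:1307.4973 — 3 statements merged into one kernel-verified Lean document; each statement's English description precedes it below -/
import Mathlib

section
/- Suppose there exist ν > 0, μ ∈ ℝ and symmetric positive definite matrices Q⁻ ∈ ℝ^{m×m}, Q⁺ ∈ ℝ^{(n−m)×(n−m)} such that, with 𝒬(x) = diag[e^{2μx} Q⁻, e^{−2μx} Q⁺], one has 𝒬(x)Λ = Λ𝒬(x) for all x ∈ [0,1], the inequality −2μ𝒬(x)Λ⁺ + Fᵀ𝒬(x) + 𝒬(x)F ≤ −2ν𝒬(x) holds for all x ∈ [0,1], and E₀ᵀ 𝒬(0) Λ E₀ ≤ E₁ᵀ 𝒬(1) Λ E₁, where E₀ = [[I_m, 0_{m,n−m}],[G₊₋, G₊₊]] and E₁ = [[G₋₋, G₋₊],[0_{n−m,m}, I_{n−m}]]. Then there exists C > 0 such that every classical solution y of the hyperbolic system satisfies ‖y(t,·)‖_{L²((0,1);ℝⁿ)} ≤ C e^{−νt} ‖y(0,·)‖_{L²((0,1);ℝⁿ)} for all t ≥ 0. -/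
open Matrix Set Real MeasureTheory

noncomputable section

/-- Loewner order on real matrices: `matLE A B` iff `B - A` is positive semidefinite. -/
def matLE {ι : Type*} [Fintype ι] (A B : Matrix ι ι ℝ) : Prop := (B - A).PosSemidef

section QuadraticForms

variable {ι : Type*} [Fintype ι]

lemma hasDerivAt_dotProduct_mulVec {g : ℝ → ι → ℝ} {g' : ι → ℝ} {A : ℝ → Matrix ι ι ℝ}
    {A' : Matrix ι ι ℝ} {x : ℝ} (hg : HasDerivAt g g' x)
    (hA : ∀ i j, HasDerivAt (fun s => A s i j) (A' i j) x) :
    HasDerivAt (fun s => g s ⬝ᵥ A s *ᵥ g s)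
      (g x ⬝ᵥ A' *ᵥ g x + (g' ⬝ᵥ A x *ᵥ g x + g x ⬝ᵥ A x *ᵥ g')) x := by
  rw [hasDerivAt_pi] at hg
  have h := HasDerivAt.fun_sum (u := Finset.univ) fun i _ =>
    (hg i).fun_mul (HasDerivAt.fun_sum (u := Finset.univ) fun j _ => (hA i j).fun_mul (hg j))
  refine h.congr_deriv ?_
  simp only [dotProduct, mulVec, Finset.mul_sum, ← Finset.sum_add_distrib]
  refine Finset.sum_congr rfl fun i _ => Finset.sum_congr rfl fun j _ => ?_
  ring

lemma ContinuousOn.dotProduct_mulVec {X : Type*} [TopologicalSpace X] {s : Set X}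
    {g h : X → ι → ℝ} {A : X → Matrix ι ι ℝ} (hg : ContinuousOn g s) (hA : ContinuousOn A s)
    (hh : ContinuousOn h s) : ContinuousOn (fun q => g q ⬝ᵥ A q *ᵥ h q) s := by
  rw [continuousOn_iff_continuous_domRestrict] at *
  exact hg.dotProduct (hA.matrix_mulVec hh)

/-- The quadratic forms of a continuous family of positive definite matrices on a compact set are
uniformly equivalent to the squared Euclidean norm. -/
lemma exists_uniform_bounds_of_posDef {K : Set ℝ} (hK : IsCompact K) {A : ℝ → Matrix ι ι ℝ}
    (hA : ContinuousOn A K) (hpos : ∀ x ∈ K, (A x).PosDef) :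
    ∃ a > 0, ∃ b > 0, ∀ x ∈ K, ∀ v : ι → ℝ,
      a * (v ⬝ᵥ v) ≤ v ⬝ᵥ A x *ᵥ v ∧ v ⬝ᵥ A x *ᵥ v ≤ b * (v ⬝ᵥ v) := by
  set S : Set (ι → ℝ) := {v | v ⬝ᵥ v = 1} with hSdef
  have hS : IsCompact S := by
    refine Metric.isCompact_of_isClosed_isBounded
      (isClosed_eq (continuous_id.dotProduct continuous_id) continuous_const) ?_
    refine (Metric.isBounded_closedBall (x := (0 : ι → ℝ)) (r := 1)).subset fun v hv => ?_
    rw [mem_closedBall_zero_iff, pi_norm_le_iff_of_nonneg zero_le_one]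
    intro i
    rw [Real.norm_eq_abs, ← sq_le_one_iff_abs_le_one, sq, ← (show v ⬝ᵥ v = 1 from hv)]
    exact Finset.single_le_sum (f := fun j => v j * v j) (fun j _ => mul_self_nonneg _)
      (Finset.mem_univ i)
  have hc : ContinuousOn (fun q : ℝ × (ι → ℝ) => q.2 ⬝ᵥ A q.1 *ᵥ q.2) (K ×ˢ S) :=
    continuousOn_snd.dotProduct_mulVec (hA.comp continuousOn_fst fun q hq => hq.1) continuousOn_snd
  obtain ⟨a, ha, hlow⟩ := (hK.prod hS).exists_forall_le' hc (a := 0) fun q hq => by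
    have hq0 : q.2 ≠ 0 := by
      intro h0
      have : q.2 ⬝ᵥ q.2 = 1 := hq.2
      simp [h0] at this
    simpa using (hpos q.1 hq.1).dotProduct_mulVec_pos hq0
  obtain ⟨b, hb⟩ := (hK.prod hS).bddAbove_image hc
  refine ⟨a, ha, max b 1, lt_max_of_lt_right one_pos, fun x hx v => ?_⟩
  rcases eq_or_ne v 0 with rfl | hv
  · simp
  have hvpos : 0 < v ⬝ᵥ v := by
    simpa using (Matrix.dotProduct_star_self_pos_iff (v := v)).2 hv
  set r := √(v ⬝ᵥ v)
  have hr : 0 < r := Real.sqrt_pos.2 hvpos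
  have hrr : r * r = v ⬝ᵥ v := Real.mul_self_sqrt hvpos.le
  have hmem : (x, r⁻¹ • v) ∈ K ×ˢ S := by
    refine ⟨hx, ?_⟩
    simp only [hSdef, mem_ofPred_eq, smul_dotProduct, dotProduct_smul, smul_eq_mul, ← hrr]
    field_simp
  have hscale : (r⁻¹ • v) ⬝ᵥ A x *ᵥ (r⁻¹ • v) = (v ⬝ᵥ A x *ᵥ v) / (v ⬝ᵥ v) := by
    simp only [mulVec_smul, smul_dotProduct, dotProduct_smul, smul_eq_mul, ← hrr]
    field_simp
  have h1 := hlow _ hmem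
  have h2 := hb (mem_image_of_mem _ hmem)
  simp only [hscale] at h1 h2
  exact ⟨(le_div_iff₀ hvpos).1 h1, (div_le_iff₀ hvpos).1 (h2.trans (le_max_left _ _))⟩

lemma matLE.dotProduct_mulVec_le {A B : Matrix ι ι ℝ} (h : matLE A B) (v : ι → ℝ) :
    v ⬝ᵥ A *ᵥ v ≤ v ⬝ᵥ B *ᵥ v := by
  have := Matrix.PosSemidef.dotProduct_mulVec_nonneg h v
  simpa [sub_mulVec, dotProduct_sub] using this

lemma Matrix.PosDef.fromBlocks_diagonal {κ : Type*} [Fintype κ] {A : Matrix ι ι ℝ}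
    {B : Matrix κ κ ℝ} (hA : A.PosDef) (hB : B.PosDef) : (fromBlocks A 0 0 B).PosDef := by
  refine .of_dotProduct_mulVec_pos (hA.isHermitian.fromBlocks (by simp) hB.isHermitian)
    fun v hv => ?_
  have hA' := hA.posSemidef.dotProduct_mulVec_nonneg (v ∘ Sum.inl)
  have hB' := hB.posSemidef.dotProduct_mulVec_nonneg (v ∘ Sum.inr)
  rw [star_trivial] at hA' hB' ⊢
  rw [fromBlocks_mulVec, ← Sum.elim_comp_inl_inr v, sumElim_dotProduct_sumElim]
  simp only [Sum.elim_comp_inl_inr, zero_mulVec, add_zero, zero_add]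
  by_cases h : v ∘ Sum.inl = 0
  · have h' : v ∘ Sum.inr ≠ 0 := fun h' => hv (by
      rw [← Sum.elim_comp_inl_inr v, h, h', Sum.elim_zero_zero])
    have := hB.dotProduct_mulVec_pos h'
    rw [star_trivial] at this
    exact add_pos_of_nonneg_of_pos hA' this
  · have := hA.dotProduct_mulVec_pos h
    rw [star_trivial] at this
    exact add_pos_of_pos_of_nonneg this hB'

lemma dotProduct_transpose_mul_mul_mulVec (E A : Matrix ι ι ℝ) (v : ι → ℝ) :
    v ⬝ᵥ (Eᵀ * A * E) *ᵥ v = (E *ᵥ v) ⬝ᵥ A *ᵥ (E *ᵥ v) := by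
  rw [← mulVec_mulVec, ← mulVec_mulVec, dotProduct_mulVec, vecMul_transpose]

/-- The time derivative of the energy density along `a + Λ b = F g`, where `a` and `b` are the time
and space derivatives of the state `g`. -/
lemma dotProduct_mulVec_add_eq_of_hyperbolic {Q L F : Matrix ι ι ℝ} (hL : Lᵀ = L)
    (hcomm : Q * L = L * Q) {g a b : ι → ℝ} (hpde : a + L *ᵥ b = F *ᵥ g) :
    a ⬝ᵥ Q *ᵥ g + g ⬝ᵥ Q *ᵥ a =
      g ⬝ᵥ (Fᵀ * Q + Q * F) *ᵥ g - (b ⬝ᵥ (Q * L) *ᵥ g + g ⬝ᵥ (Q * L) *ᵥ b) := by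
  have h1 : b ⬝ᵥ (Q * L) *ᵥ g = (L *ᵥ b) ⬝ᵥ Q *ᵥ g := by
    rw [hcomm, ← mulVec_mulVec, dotProduct_mulVec, ← mulVec_transpose, hL]
  have h2 : g ⬝ᵥ (Fᵀ * Q) *ᵥ g = (F *ᵥ g) ⬝ᵥ Q *ᵥ g := by
    rw [← mulVec_mulVec, dotProduct_mulVec, vecMul_transpose]
  rw [eq_sub_of_add_eq hpde, h1, add_mulVec, dotProduct_add, h2, ← mulVec_mulVec, ← mulVec_mulVec,
    sub_dotProduct, mulVec_sub, dotProduct_sub]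
  ring

end QuadraticForms

section ParametricIntegrals

lemma ContinuousOn.comp_prodMk_left {E : Type*} [TopologicalSpace E] {f : ℝ × ℝ → E} {s u : Set ℝ}
    (hf : ContinuousOn f (s ×ˢ u)) {t : ℝ} (ht : t ∈ s) : ContinuousOn (fun x => f (t, x)) u :=
  hf.comp (by fun_prop) fun _ hx => ⟨ht, hx⟩

lemma continuousOn_integral_unitInterval {f : ℝ × ℝ → ℝ}
    (hf : ContinuousOn f (Ici (0:ℝ) ×ˢ Icc (0:ℝ) 1)) :
    ContinuousOn (fun t => ∫ x in (0:ℝ)..1, f (t, x)) (Ici 0) := by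
  have hproj : Continuous fun q : ℝ × ℝ =>
      f (max 0 q.1, projIcc (0:ℝ) 1 zero_le_one q.2) := by
    refine hf.comp_continuous ?_ fun q => ⟨mem_Ici.2 (le_max_left _ _), Subtype.coe_prop _⟩
    exact (continuous_const.max continuous_fst).prodMk
      (continuous_subtype_val.comp (continuous_projIcc.comp continuous_snd))
  have hint : Continuous fun t => ∫ x in (0:ℝ)..1,
      f (max 0 t, projIcc (0:ℝ) 1 zero_le_one x) :=
    intervalIntegral.continuous_parametric_intervalIntegral_of_continuous'
      (f := fun t x => f (max 0 t, projIcc (0:ℝ) 1 zero_le_one x)) hproj 0 1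
  refine hint.continuousOn.congr fun t ht => intervalIntegral.integral_congr fun x hx => ?_
  rw [uIcc_of_le zero_le_one] at hx
  simp only [max_eq_right (mem_Ici.1 ht), projIcc_of_mem zero_le_one hx]

lemma hasDerivAt_integral_unitInterval {f f' : ℝ × ℝ → ℝ}
    (hf : ContinuousOn f (Ici (0:ℝ) ×ˢ Icc (0:ℝ) 1))
    (hf' : ContinuousOn f' (Ici (0:ℝ) ×ˢ Icc (0:ℝ) 1))
    (hd : ∀ t > 0, ∀ x ∈ Icc (0:ℝ) 1, HasDerivAt (fun s => f (s, x)) (f' (t, x)) t)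
    {t : ℝ} (ht : 0 < t) :
    HasDerivAt (fun s => ∫ x in (0:ℝ)..1, f (s, x)) (∫ x in (0:ℝ)..1, f' (t, x)) t := by
  have hint {g : ℝ × ℝ → ℝ} (hg : ContinuousOn g (Ici (0:ℝ) ×ˢ Icc (0:ℝ) 1)) {s : ℝ}
      (hs : 0 ≤ s) : IntervalIntegrable (fun x => g (s, x)) volume 0 1 :=
    ContinuousOn.intervalIntegrable_of_Icc zero_le_one (hg.comp_prodMk_left hs)
  have hmeas {g : ℝ × ℝ → ℝ} (hg : ContinuousOn g (Ici (0:ℝ) ×ˢ Icc (0:ℝ) 1)) {s : ℝ}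
      (hs : 0 ≤ s) :
      AEStronglyMeasurable (fun x => g (s, x)) (volume.restrict (uIoc (0:ℝ) 1)) :=
    (intervalIntegrable_iff.1 (hint hg hs)).aestronglyMeasurable
  obtain ⟨M, hM⟩ := ((isCompact_Icc (a := t / 2) (b := 2 * t)).prod
    (isCompact_Icc (a := (0:ℝ)) (b := 1))).exists_bound_of_continuousOn
    (hf'.mono (prod_mono (fun s hs => (half_pos ht).le.trans hs.1) subset_rfl))
  have hIoc {x : ℝ} (hx : x ∈ uIoc (0:ℝ) 1) : x ∈ Icc (0:ℝ) 1 := by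
    rw [uIoc_of_le zero_le_one] at hx
    exact Ioc_subset_Icc_self hx
  refine (intervalIntegral.hasDerivAt_integral_of_dominated_loc_of_deriv_le
    (F := fun s x => f (s, x)) (F' := fun s x => f' (s, x)) (bound := fun _ => M)
    (Icc_mem_nhds (half_lt_self ht) (by linarith : t < 2 * t)) ?_ (hint hf ht.le) (hmeas hf' ht.le)
    (.of_forall fun x hx s hs => hM (s, x) ⟨hs, hIoc hx⟩) intervalIntegrable_const
    (.of_forall fun x hx s hs => hd s ((half_pos ht).trans_le hs.1) x (hIoc hx))).2
  filter_upwards [Ioi_mem_nhds ht] with s hs using hmeas hf (le_of_lt hs)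

end ParametricIntegrals

section EnergyEstimate

variable {ι : Type*} [Fintype ι] [DecidableEq ι]

/-- Exponential decay of the weighted energy of a classical solution of `∂ₜ y + Λ ∂ₓ y = F y`. -/
lemma integral_energy_le_exp_mul {lam : ι → ℝ} {F : Matrix ι ι ℝ} {ν : ℝ} {Q R : ℝ → Matrix ι ι ℝ}
    (hQ : ContinuousOn Q (Icc 0 1)) (hR : ContinuousOn R (Icc 0 1))
    (hQR : ∀ x ∈ Icc (0:ℝ) 1, ∀ i j,
      HasDerivAt (fun s => (Q s * diagonal lam) i j) (R x i j) x)
    (hcomm : ∀ x ∈ Icc (0:ℝ) 1, Q x * diagonal lam = diagonal lam * Q x)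
    (hdiss : ∀ x ∈ Icc (0:ℝ) 1, ∀ v : ι → ℝ,
      v ⬝ᵥ (R x + (Fᵀ * Q x + Q x * F)) *ᵥ v ≤ -(2 * ν) * (v ⬝ᵥ Q x *ᵥ v))
    {y : ℝ → ℝ → ι → ℝ}
    (hy : ContDiffOn ℝ 1 (fun q : ℝ × ℝ => y q.1 q.2) (Ici (0:ℝ) ×ˢ Icc (0:ℝ) 1))
    (hpde : ∀ t ∈ Ici (0:ℝ), ∀ x ∈ Icc (0:ℝ) 1,
      fderivWithin ℝ (fun q : ℝ × ℝ => y q.1 q.2) (Ici (0:ℝ) ×ˢ Icc (0:ℝ) 1) (t, x) (1, 0)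
        + (diagonal lam).mulVec (fderivWithin ℝ (fun q : ℝ × ℝ => y q.1 q.2)
            (Ici (0:ℝ) ×ˢ Icc (0:ℝ) 1) (t, x) (0, 1))
        = F.mulVec (y t x))
    (hbd : ∀ t ∈ Ici (0:ℝ), y t 0 ⬝ᵥ (Q 0 * diagonal lam) *ᵥ y t 0 ≤
      y t 1 ⬝ᵥ (Q 1 * diagonal lam) *ᵥ y t 1) {t : ℝ} (ht : 0 ≤ t) :
    ∫ x in (0:ℝ)..1, y t x ⬝ᵥ Q x *ᵥ y t x ≤
      Real.exp (-(2 * ν) * t) * ∫ x in (0:ℝ)..1, y 0 x ⬝ᵥ Q x *ᵥ y 0 x := by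
  set S : Set (ℝ × ℝ) := Ici (0:ℝ) ×ˢ Icc (0:ℝ) 1
  set Y : ℝ × ℝ → ι → ℝ := fun q => y q.1 q.2
  set a : ℝ × ℝ → ι → ℝ := fun q => fderivWithin ℝ Y S q (1, 0)
  set b : ℝ × ℝ → ι → ℝ := fun q => fderivWithin ℝ Y S q (0, 1)
  have hS : UniqueDiffOn ℝ S := (uniqueDiffOn_Ici 0).prod (uniqueDiffOn_Icc zero_lt_one)
  have hD := hy.continuousOn_fderivWithin hS le_rfl
  have hYc : ContinuousOn Y S := hy.continuousOn
  have hac : ContinuousOn a S := hD.clm_apply continuousOn_const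
  have hbc : ContinuousOn b S := hD.clm_apply continuousOn_const
  have hQc : ContinuousOn (fun q : ℝ × ℝ => Q q.2) S := hQ.comp continuousOn_snd fun q hq => hq.2
  have hRc : ContinuousOn (fun q : ℝ × ℝ => R q.2) S := hR.comp continuousOn_snd fun q hq => hq.2
  have hLc : ContinuousOn (fun q : ℝ × ℝ => Q q.2 * diagonal lam) S := by
    rw [continuousOn_iff_continuous_domRestrict] at hQc ⊢
    exact hQc.matrix_mul continuous_const
  have hYt : ∀ s > 0, ∀ x ∈ Icc (0:ℝ) 1, HasDerivAt (fun s => y s x) (a (s, x)) s := by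
    intro s hs x hx
    have h := (hy.differentiableOn one_ne_zero (s, x) ⟨hs.le, hx⟩).hasFDerivWithinAt
    refine h.comp_hasDerivAt s ((hasDerivAt_id s).prodMk (hasDerivAt_const s x)) ?_
    filter_upwards [Ioi_mem_nhds hs] with r hr using ⟨mem_Ici.2 (le_of_lt hr), hx⟩
  have hYx : ∀ s ≥ 0, ∀ x ∈ Ioo (0:ℝ) 1, HasDerivAt (fun x => y s x) (b (s, x)) x := by
    intro s hs x hx
    have h := (hy.differentiableOn one_ne_zero (s, x)
      ⟨hs, Ioo_subset_Icc_self hx⟩).hasFDerivWithinAt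
    refine h.comp_hasDerivAt x ((hasDerivAt_const x s).prodMk (hasDerivAt_id x)) ?_
    filter_upwards [Icc_mem_nhds hx.1 hx.2] with r hr using ⟨hs, hr⟩
  set f : ℝ × ℝ → ℝ := fun q => Y q ⬝ᵥ Q q.2 *ᵥ Y q
  set f' : ℝ × ℝ → ℝ := fun q => a q ⬝ᵥ Q q.2 *ᵥ Y q + Y q ⬝ᵥ Q q.2 *ᵥ a q
  set w : ℝ × ℝ → ℝ := fun q => Y q ⬝ᵥ (Q q.2 * diagonal lam) *ᵥ Y q
  set w' : ℝ × ℝ → ℝ := fun q => Y q ⬝ᵥ R q.2 *ᵥ Y q +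
    (b q ⬝ᵥ (Q q.2 * diagonal lam) *ᵥ Y q + Y q ⬝ᵥ (Q q.2 * diagonal lam) *ᵥ b q)
  have hfc : ContinuousOn f S := hYc.dotProduct_mulVec hQc hYc
  have hf'c : ContinuousOn f' S :=
    (hac.dotProduct_mulVec hQc hYc).add (hYc.dotProduct_mulVec hQc hac)
  have hwc : ContinuousOn w S := hYc.dotProduct_mulVec hLc hYc
  have hw'c : ContinuousOn w' S := (hYc.dotProduct_mulVec hRc hYc).add
    ((hbc.dotProduct_mulVec hLc hYc).add (hYc.dotProduct_mulVec hLc hbc))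
  have hint {g : ℝ × ℝ → ℝ} (hg : ContinuousOn g S) {s : ℝ} (hs : 0 ≤ s) :
      IntervalIntegrable (fun x => g (s, x)) volume 0 1 :=
    ContinuousOn.intervalIntegrable_of_Icc zero_le_one (hg.comp_prodMk_left hs)
  set V : ℝ → ℝ := fun s => ∫ x in (0:ℝ)..1, f (s, x)
  have hV : ∀ s > 0, HasDerivAt V (∫ x in (0:ℝ)..1, f' (s, x)) s := fun s hs =>
    hasDerivAt_integral_unitInterval hfc hf'c (fun r hr x hx => by
      simpa using hasDerivAt_dotProduct_mulVec (A := fun _ => Q x) (A' := 0) (hYt r hr x hx)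
        fun i j => hasDerivAt_const _ _) hs
  have hV' : ∀ s > 0, ∫ x in (0:ℝ)..1, f' (s, x) ≤ -(2 * ν) * V s := by
    intro s hs
    have hflux : ∫ x in (0:ℝ)..1, w' (s, x) = w (s, 1) - w (s, 0) :=
      intervalIntegral.integral_eq_sub_of_hasDerivAt_of_le zero_le_one
        (f := fun x => w (s, x)) (hwc.comp_prodMk_left (mem_Ici.2 hs.le))
        (fun x hx => hasDerivAt_dotProduct_mulVec (hYx s hs.le x hx)
          (hQR x (Ioo_subset_Icc_self hx))) (hint hw'c hs.le)
    have hpt : ∀ x ∈ Icc (0:ℝ) 1, f' (s, x) ≤ -(2 * ν) * f (s, x) - w' (s, x) := by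
      intro x hx
      have h1 := dotProduct_mulVec_add_eq_of_hyperbolic (diagonal_transpose lam) (hcomm x hx)
        (hpde s hs.le x hx)
      have h2 := hdiss x hx (y s x)
      rw [add_mulVec, dotProduct_add] at h2
      simp only [f', f, w', Y]
      linarith
    have hle := intervalIntegral.integral_mono_on zero_le_one (hint hf'c hs.le)
      (((hint hfc hs.le).const_mul _).sub (hint hw'c hs.le)) hpt
    rw [intervalIntegral.integral_sub ((hint hfc hs.le).const_mul _) (hint hw'c hs.le),
      intervalIntegral.integral_const_mul, hflux] at hle
    have hb : w (s, 0) ≤ w (s, 1) := hbd s hs.le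
    linarith
  have hW : ∀ s > 0, HasDerivAt (fun r => Real.exp (2 * ν * r) * V r)
      (Real.exp (2 * ν * s) * (2 * ν) * V s +
        Real.exp (2 * ν * s) * ∫ x in (0:ℝ)..1, f' (s, x)) s := fun s hs =>
    (((hasDerivAt_id s).const_mul (2 * ν)).exp.congr_deriv (by simp)).mul (hV s hs)
  have hanti : AntitoneOn (fun r => Real.exp (2 * ν * r) * V r) (Ici 0) := by
    refine antitoneOn_of_deriv_nonpos (convex_Ici 0)
      (.mul (by fun_prop) (continuousOn_integral_unitInterval hfc)) ?_ ?_
    · rw [interior_Ici]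
      exact fun s hs => (hW s hs).differentiableAt.differentiableWithinAt
    · rw [interior_Ici]
      intro s hs
      rw [(hW s hs).deriv]
      have := mul_le_mul_of_nonneg_left (hV' s hs) (Real.exp_pos (2 * ν * s)).le
      linarith
  have h0 : Real.exp (2 * ν * t) * V t ≤ V 0 := by
    simpa using hanti (mem_Ici.2 le_rfl) (mem_Ici.2 ht) ht
  calc V t = Real.exp (-(2 * ν) * t) * (Real.exp (2 * ν * t) * V t) := by
        rw [← mul_assoc, ← Real.exp_add, neg_mul, neg_add_cancel, Real.exp_zero, one_mul]
    _ ≤ _ := mul_le_mul_of_nonneg_left h0 (Real.exp_pos _).le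

end EnergyEstimate

/-- Proposition 1 (GES of the linear hyperbolic system under the Lyapunov matrix
inequalities).  The state index is `Fin m ⊕ Fin p` with `n = m + p`, the first `m`
components corresponding to negative characteristic velocities. -/
theorem stmt_0
    (m p : ℕ) (hn : 1 ≤ m + p)
    (lam : (Fin m ⊕ Fin p) → ℝ)
    (hneg : ∀ k : Fin m, lam (Sum.inl k) < 0)
    (hpos : ∀ k : Fin p, 0 < lam (Sum.inr k))
    (F G : Matrix (Fin m ⊕ Fin p) (Fin m ⊕ Fin p) ℝ)
    (ν μ : ℝ) (hν : 0 < ν)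
    (Qm : Matrix (Fin m) (Fin m) ℝ) (Qp : Matrix (Fin p) (Fin p) ℝ)
    (hQm : Qm.PosDef) (hQp : Qp.PosDef)
    (Qx : ℝ → Matrix (Fin m ⊕ Fin p) (Fin m ⊕ Fin p) ℝ)
    (hQx : ∀ x : ℝ, Qx x =
      Matrix.fromBlocks (Real.exp (2 * μ * x) • Qm) 0 0 (Real.exp (-(2 * μ * x)) • Qp))
    (hcomm : ∀ x ∈ Icc (0:ℝ) 1,
      Qx x * Matrix.diagonal lam = Matrix.diagonal lam * Qx x)
    (hlmi1 : ∀ x ∈ Icc (0:ℝ) 1,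
      matLE (-(2 * μ) • (Qx x * Matrix.diagonal (fun k => |lam k|))
              + Fᵀ * Qx x + Qx x * F)
            (-(2 * ν) • Qx x))
    (hlmi2 :
      matLE ((Matrix.fromBlocks 1 0 G.toBlocks₂₁ G.toBlocks₂₂)ᵀ
               * (Qx 0 * Matrix.diagonal lam)
               * Matrix.fromBlocks 1 0 G.toBlocks₂₁ G.toBlocks₂₂)
            ((Matrix.fromBlocks G.toBlocks₁₁ G.toBlocks₁₂ 0 1)ᵀ
               * (Qx 1 * Matrix.diagonal lam)
               * Matrix.fromBlocks G.toBlocks₁₁ G.toBlocks₁₂ 0 1)) :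
    ∃ C > (0:ℝ), ∀ y : ℝ → ℝ → (Fin m ⊕ Fin p) → ℝ,
      -- `y` is C¹ on [0,∞) × [0,1]
      ContDiffOn ℝ 1 (fun q : ℝ × ℝ => y q.1 q.2) (Ici (0:ℝ) ×ˢ Icc (0:ℝ) 1) →
      -- the hyperbolic PDE ∂ₜ y + Λ ∂ₓ y = F y
      (∀ t ∈ Ici (0:ℝ), ∀ x ∈ Icc (0:ℝ) 1,
        fderivWithin ℝ (fun q : ℝ × ℝ => y q.1 q.2) (Ici (0:ℝ) ×ˢ Icc (0:ℝ) 1) (t, x) (1, 0)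
          + (Matrix.diagonal lam).mulVec
              (fderivWithin ℝ (fun q : ℝ × ℝ => y q.1 q.2)
                (Ici (0:ℝ) ×ˢ Icc (0:ℝ) 1) (t, x) (0, 1))
          = F.mulVec (y t x)) →
      -- the boundary condition (y⁻(t,1), y⁺(t,0)) = G (y⁻(t,0), y⁺(t,1))
      (∀ t ∈ Ici (0:ℝ),
        Sum.elim (fun k => y t 1 (Sum.inl k)) (fun k => y t 0 (Sum.inr k))
          = G.mulVec (Sum.elim (fun k => y t 0 (Sum.inl k)) (fun k => y t 1 (Sum.inr k)))) →
      ∀ t ≥ (0:ℝ),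
        Real.sqrt (∫ x in (0:ℝ)..1, ∑ k, (y t x k) ^ 2)
          ≤ C * Real.exp (-ν * t) * Real.sqrt (∫ x in (0:ℝ)..1, ∑ k, (y 0 x k) ^ 2) := by
  have hQc : Continuous Qx := by
    rw [show Qx = _ from funext hQx]
    exact Continuous.matrix_fromBlocks (by fun_prop) continuous_const continuous_const (by fun_prop)
  have hQpos : ∀ x, (Qx x).PosDef := fun x => by
    rw [hQx]
    exact (hQm.smul (Real.exp_pos _)).fromBlocks_diagonal (hQp.smul (Real.exp_pos _))
  obtain ⟨c, hc, d, hd, hcd⟩ := exists_uniform_bounds_of_posDef (isCompact_Icc (a := (0:ℝ)) (b := 1))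
    hQc.continuousOn fun x _ => hQpos x
  have hQR : ∀ x ∈ Icc (0:ℝ) 1, ∀ i j, HasDerivAt (fun s => (Qx s * diagonal lam) i j)
      ((-(2 * μ) • (Qx x * diagonal fun k => |lam k|)) i j) x := by
    intro x _ i j
    have hexp (r : ℝ) : HasDerivAt (fun s => Real.exp (r * s)) (Real.exp (r * x) * r) x :=
      ((hasDerivAt_id x).const_mul r).exp.congr_deriv (by simp)
    simp only [hQx, mul_diagonal, Matrix.smul_apply, smul_eq_mul]
    rcases i with i | i <;> rcases j with j | j
    · simp only [fromBlocks_apply₁₁, Matrix.smul_apply, smul_eq_mul, abs_of_neg (hneg j)]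
      exact (((hexp (2 * μ)).mul_const _).mul_const _).congr_deriv (by ring)
    · simpa using hasDerivAt_const x (0:ℝ)
    · simpa using hasDerivAt_const x (0:ℝ)
    · simp only [fromBlocks_apply₂₂, Matrix.smul_apply, smul_eq_mul, abs_of_pos (hpos j),
        ← neg_mul]
      exact (((hexp (-2 * μ)).mul_const _).mul_const _).congr_deriv (by ring)
  refine ⟨√(d / c), Real.sqrt_pos.2 (div_pos hd hc), fun y hy hpde hbc t ht => ?_⟩
  have hbd : ∀ t ∈ Ici (0:ℝ), y t 0 ⬝ᵥ (Qx 0 * diagonal lam) *ᵥ y t 0 ≤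
      y t 1 ⬝ᵥ (Qx 1 * diagonal lam) *ᵥ y t 1 := by
    intro t ht
    have h := hbc t ht
    set u : Fin m ⊕ Fin p → ℝ :=
      Sum.elim (fun k => y t 0 (Sum.inl k)) (fun k => y t 1 (Sum.inr k)) with hu
    rw [← fromBlocks_toBlocks G, fromBlocks_mulVec] at h
    have h0 : fromBlocks 1 0 G.toBlocks₂₁ G.toBlocks₂₂ *ᵥ u = y t 0 := by
      rw [fromBlocks_mulVec]
      funext k
      rcases k with k | k
      · simp [hu]
      · simpa using (congrFun h (Sum.inr k)).symm
    have h1 : fromBlocks G.toBlocks₁₁ G.toBlocks₁₂ 0 1 *ᵥ u = y t 1 := by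
      rw [fromBlocks_mulVec]
      funext k
      rcases k with k | k
      · simpa using (congrFun h (Sum.inl k)).symm
      · simp [hu]
    have := hlmi2.dotProduct_mulVec_le u
    rwa [dotProduct_transpose_mul_mul_mulVec, dotProduct_transpose_mul_mul_mulVec, h0, h1] at this
  have hdiss : ∀ x ∈ Icc (0:ℝ) 1, ∀ v, v ⬝ᵥ (-(2 * μ) • (Qx x * diagonal fun k => |lam k|)
      + (Fᵀ * Qx x + Qx x * F)) *ᵥ v ≤ -(2 * ν) * (v ⬝ᵥ Qx x *ᵥ v) := by
    intro x hx v
    have := (hlmi1 x hx).dotProduct_mulVec_le v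
    rwa [add_assoc, smul_mulVec (-(2 * ν)), dotProduct_smul, smul_eq_mul] at this
  have hdecay := integral_energy_le_exp_mul hQc.continuousOn
    ((hQc.matrix_mul continuous_const).const_smul (-(2 * μ))).continuousOn hQR hcomm hdiss hy hpde
    hbd ht
  have hyc {s : ℝ} (hs : 0 ≤ s) : ContinuousOn (y s) (Icc 0 1) :=
    hy.continuousOn.comp_prodMk_left (mem_Ici.2 hs)
  have henergy {s : ℝ} (hs : 0 ≤ s) :
      IntervalIntegrable (fun x => y s x ⬝ᵥ Qx x *ᵥ y s x) volume 0 1 :=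
    ContinuousOn.intervalIntegrable_of_Icc zero_le_one
      ((hyc hs).dotProduct_mulVec hQc.continuousOn (hyc hs))
  have hsq {s : ℝ} (hs : 0 ≤ s) :
      IntervalIntegrable (fun x => y s x ⬝ᵥ y s x) volume 0 1 :=
    ContinuousOn.intervalIntegrable_of_Icc zero_le_one (by
      simpa using (hyc hs).dotProduct_mulVec (A := fun _ => 1) continuousOn_const (hyc hs))
  have hlow : c * ∫ x in (0:ℝ)..1, y t x ⬝ᵥ y t x ≤ ∫ x in (0:ℝ)..1, y t x ⬝ᵥ Qx x *ᵥ y t x := by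
    rw [← intervalIntegral.integral_const_mul]
    exact intervalIntegral.integral_mono_on zero_le_one ((hsq ht).const_mul _) (henergy ht)
      fun x hx => (hcd x hx _).1
  have hup : ∫ x in (0:ℝ)..1, y 0 x ⬝ᵥ Qx x *ᵥ y 0 x ≤ d * ∫ x in (0:ℝ)..1, y 0 x ⬝ᵥ y 0 x := by
    rw [← intervalIntegral.integral_const_mul]
    exact intervalIntegral.integral_mono_on zero_le_one (henergy le_rfl) ((hsq le_rfl).const_mul _)
      fun x hx => (hcd x hx _).2
  have hsum (v : Fin m ⊕ Fin p → ℝ) : ∑ k, v k ^ 2 = v ⬝ᵥ v := by simp only [dotProduct, sq]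
  simp only [hsum]
  have hexp : Real.exp (-ν * t) = √(Real.exp (-(2 * ν) * t)) := by
    rw [← Real.exp_half]
    ring_nf
  rw [hexp, ← Real.sqrt_mul (div_pos hd hc).le,
    ← Real.sqrt_mul (mul_nonneg (div_pos hd hc).le (Real.exp_pos _).le)]
  refine Real.sqrt_le_sqrt ?_
  rw [div_mul_eq_mul_div, div_mul_eq_mul_div, le_div_iff₀ hc, mul_comm, mul_comm d, mul_assoc]
  exact hlow.trans (hdecay.trans (mul_le_mul_of_nonneg_left hup (Real.exp_pos _).le))
end
end

section
/- Assume m = 0 (i.e. Λ is diagonal positive definite) and that there exists a diagonal positive definite matrix M ∈ ℝ^{n×n} and μ ∈ ℝ such that V(y) = yᵀMy is a common Lyapunov function for the continuous-time system ẏ(t) = (Λ⁻¹F − μIₙ) y(t) and the discrete-time system y(t+1) = (e^{μ}G) y(t); that is, (Λ⁻¹F − μIₙ)ᵀM + M(Λ⁻¹F − μIₙ) is negative definite and e^{2μ}GᵀMG ≤ M. Then the hyperbolic system is globally exponentially stable: there exist ν > 0 and C > 0 such that every classical solution y satisfies ‖y(t,·)‖_{L²((0,1);ℝⁿ)} ≤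 C e^{−νt} ‖y(0,·)‖_{L²((0,1);ℝⁿ)} for all t ≥ 0. -/
open Matrix Set Real

noncomputable section

/-- The space-time strip `[0,∞) × [0,1]`. -/
abbrev strip : Set (ℝ × ℝ) := Ici (0:ℝ) ×ˢ Icc (0:ℝ) 1

/-- The retraction of the plane onto the strip. -/
def stripProj (q : ℝ × ℝ) : ℝ × ℝ := (max q.1 0, max 0 (min q.2 1))

lemma continuous_stripProj : Continuous stripProj := by
  unfold stripProj; fun_prop

lemma stripProj_mem (q : ℝ × ℝ) : stripProj q ∈ strip :=
  ⟨mem_Ici.2 (le_max_right _ _), le_max_left _ _, max_le zero_le_one (min_le_right _ _)⟩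

lemma stripProj_of_mem {q : ℝ × ℝ} (hq : q ∈ strip) : stripProj q = q := by
  obtain ⟨h1, h2, h3⟩ := hq
  have h1 : 0 ≤ q.1 := h1
  simp [stripProj, h1, h2, h3]

lemma continuous_comp_stripProj {g : ℝ × ℝ → ℝ} (hg : ContinuousOn g strip) :
    Continuous (g ∘ stripProj) :=
  hg.comp_continuous continuous_stripProj stripProj_mem

lemma integral_comp_stripProj (g : ℝ × ℝ → ℝ) {t : ℝ} (ht : 0 ≤ t) :
    ∫ x in (0:ℝ)..1, (g ∘ stripProj) (t, x) = ∫ x in (0:ℝ)..1, g (t, x) := by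
  refine intervalIntegral.integral_congr fun x hx => ?_
  rw [uIcc_of_le zero_le_one] at hx
  simp only [Function.comp, stripProj_of_mem (show (t, x) ∈ strip from ⟨ht, hx⟩)]

lemma continuousOn_slice {g : ℝ × ℝ → ℝ} (hg : ContinuousOn g strip) {t : ℝ} (ht : 0 ≤ t) :
    ContinuousOn (fun x => g (t, x)) (Icc 0 1) :=
  hg.comp (by fun_prop) fun _ hx => ⟨ht, hx⟩

lemma intervalIntegrable_slice {g : ℝ × ℝ → ℝ} (hg : ContinuousOn g strip) {t : ℝ} (ht : 0 ≤ t) :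
    IntervalIntegrable (fun x => g (t, x)) MeasureTheory.volume 0 1 :=
  ContinuousOn.intervalIntegrable (by
    rw [uIcc_of_le zero_le_one]; exact continuousOn_slice hg ht)

lemma continuousOn_integral_strip {g : ℝ × ℝ → ℝ} (hg : ContinuousOn g strip) :
    ContinuousOn (fun t => ∫ x in (0:ℝ)..1, g (t, x)) (Ici 0) := by
  have h : Continuous fun t => ∫ x in (0:ℝ)..1, (g ∘ stripProj) (t, x) :=
    intervalIntegral.continuous_parametric_intervalIntegral_of_continuous'
      (f := fun t x => (g ∘ stripProj) (t, x)) (continuous_comp_stripProj hg) 0 1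
  exact h.continuousOn.congr fun t ht => (integral_comp_stripProj g ht).symm

lemma hasDerivAt_integral_strip {g g' : ℝ × ℝ → ℝ} (hg : ContinuousOn g strip)
    (hg' : ContinuousOn g' strip)
    (hd : ∀ t > 0, ∀ x ∈ Icc (0:ℝ) 1, HasDerivAt (fun s => g (s, x)) (g' (t, x)) t)
    {t : ℝ} (ht : 0 < t) :
    HasDerivAt (fun s => ∫ x in (0:ℝ)..1, g (s, x)) (∫ x in (0:ℝ)..1, g' (t, x)) t := by
  have hsub : Icc (t / 2) (t + 1) ×ˢ Icc (0:ℝ) 1 ⊆ strip :=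
    Set.prod_mono (fun s hs => le_trans (by positivity) hs.1) subset_rfl
  obtain ⟨K, hK⟩ := (isCompact_Icc.prod isCompact_Icc).exists_bound_of_continuousOn
    (hg'.mono hsub)
  have hIoc : ∀ x ∈ uIoc (0:ℝ) 1, x ∈ Icc (0:ℝ) 1 := fun x hx => by
    rw [uIoc_of_le zero_le_one] at hx; exact Ioc_subset_Icc_self hx
  refine (intervalIntegral.hasDerivAt_integral_of_dominated_loc_of_deriv_le
    (F := fun s x => g (s, x)) (F' := fun s x => g' (s, x)) (bound := fun _ => K)
    (Icc_mem_nhds (by linarith : t / 2 < t) (by linarith : t < t + 1)) ?_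
    (intervalIntegrable_slice hg ht.le) (intervalIntegrable_slice hg' ht.le).def'.1
    ?_ intervalIntegrable_const ?_).2
  · filter_upwards [lt_mem_nhds ht] with s hs
    exact (intervalIntegrable_slice hg hs.le).def'.1
  · exact Filter.Eventually.of_forall fun x hx s hs => hK (s, x) ⟨hs, hIoc x hx⟩
  · exact Filter.Eventually.of_forall fun x hx s hs =>
      hd s (lt_of_lt_of_le (by positivity) hs.1) x (hIoc x hx)

/-- Differential form of Grönwall's inequality for exponential decay. -/
lemma le_exp_mul_of_hasDerivAt_le {W W' : ℝ → ℝ} {a : ℝ} (hW : ContinuousOn W (Ici 0))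
    (hW' : ∀ t > 0, HasDerivAt W (W' t) t) (hle : ∀ t > 0, W' t ≤ -a * W t)
    {t : ℝ} (ht : 0 ≤ t) : W t ≤ Real.exp (-a * t) * W 0 := by
  have hder : ∀ s > 0, HasDerivAt (fun s => Real.exp (a * s) * W s)
      (Real.exp (a * s) * (a * W s + W' s)) s := fun s hs => by
    refine ((((hasDerivAt_id' s).const_mul a).exp).fun_mul (hW' s hs)).congr_deriv ?_
    ring
  have hanti : AntitoneOn (fun s => Real.exp (a * s) * W s) (Ici 0) := by
    apply antitoneOn_of_deriv_nonpos (convex_Ici 0)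
    · exact ContinuousOn.mul (by fun_prop) hW
    · rw [interior_Ici]
      exact fun s hs => (hder s hs).differentiableAt.differentiableWithinAt
    · rw [interior_Ici]
      intro s hs
      rw [(hder s hs).deriv]
      have := hle s hs
      exact mul_nonpos_of_nonneg_of_nonpos (Real.exp_pos _).le (by linarith)
  have h := hanti (mem_Ici.2 le_rfl) ht ht
  simp only [mul_zero, Real.exp_zero, one_mul] at h
  calc W t = Real.exp (-a * t) * (Real.exp (a * t) * W t) := by
        rw [← mul_assoc, ← Real.exp_add]; simp
    _ ≤ _ := mul_le_mul_of_nonneg_left h (Real.exp_pos _).le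

lemma exists_pos_mul_sum_sq_le {ι : Type*} [Fintype ι] {P : Matrix ι ι ℝ} (hP : P.PosDef) :
    ∃ c > 0, ∀ v : ι → ℝ, c * ∑ k, v k ^ 2 ≤ v ⬝ᵥ (P *ᵥ v) := by
  rcases isEmpty_or_nonempty ι with h | h
  · exact ⟨1, one_pos, fun v => by simp⟩
  have hcont : Continuous fun v : ι → ℝ => v ⬝ᵥ (P *ᵥ v) := by fun_prop
  obtain ⟨u, hu, hmin⟩ := (isCompact_sphere (0 : ι → ℝ) 1).exists_isMinOn
    ((NormedSpace.sphere_nonempty).2 zero_le_one) hcont.continuousOn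
  have hu0 : u ≠ 0 := by
    rintro rfl
    simp at hu
  have hc : 0 < u ⬝ᵥ (P *ᵥ u) := by simpa using hP.dotProduct_mulVec_pos hu0
  have hcard : (0:ℝ) < Fintype.card ι := by exact_mod_cast Fintype.card_pos
  refine ⟨(u ⬝ᵥ (P *ᵥ u)) / Fintype.card ι, by positivity, fun v => ?_⟩
  have hsum : ∑ k, v k ^ 2 ≤ Fintype.card ι * ‖v‖ ^ 2 := by
    calc ∑ k, v k ^ 2 ≤ ∑ _k : ι, ‖v‖ ^ 2 := Finset.sum_le_sum fun k _ => by
          rw [← sq_abs]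
          exact pow_le_pow_left₀ (abs_nonneg _) (norm_le_pi_norm v k) 2
      _ = _ := by simp
  have hscale : (u ⬝ᵥ (P *ᵥ u)) * ‖v‖ ^ 2 ≤ v ⬝ᵥ (P *ᵥ v) := by
    rcases eq_or_ne v 0 with rfl | hv
    · simp
    have hv' : 0 < ‖v‖ := norm_pos_iff.2 hv
    have h1 : ‖v‖⁻¹ • v ∈ Metric.sphere (0 : ι → ℝ) 1 := by
      simp [norm_smul, hv'.ne']
    have h2 : u ⬝ᵥ (P *ᵥ u) ≤ (‖v‖⁻¹ • v) ⬝ᵥ (P *ᵥ (‖v‖⁻¹ • v)) := hmin h1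
    rw [Matrix.mulVec_smul, smul_dotProduct, dotProduct_smul, smul_eq_mul, smul_eq_mul] at h2
    calc (u ⬝ᵥ (P *ᵥ u)) * ‖v‖ ^ 2
        ≤ (‖v‖⁻¹ * (‖v‖⁻¹ * (v ⬝ᵥ (P *ᵥ v)))) * ‖v‖ ^ 2 := by gcongr
      _ = _ := by field_simp
  calc _ ≤ (u ⬝ᵥ (P *ᵥ u)) / Fintype.card ι * (Fintype.card ι * ‖v‖ ^ 2) := by gcongr
    _ = (u ⬝ᵥ (P *ᵥ u)) * ‖v‖ ^ 2 := by field_simp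
    _ ≤ _ := hscale

lemma exists_sum_sq_bounds {ι : Type*} [Fintype ι] {r : ι → ℝ} (hr : ∀ k, 0 < r k) :
    ∃ a > 0, ∃ b > 0, ∀ v : ι → ℝ,
      a * ∑ k, v k ^ 2 ≤ ∑ k, r k * v k ^ 2 ∧ ∑ k, r k * v k ^ 2 ≤ b * ∑ k, v k ^ 2 := by
  have hinv : 0 ≤ ∑ k, (r k)⁻¹ := Finset.sum_nonneg fun k _ => (inv_pos.2 (hr k)).le
  have hsum : 0 ≤ ∑ k, r k := Finset.sum_nonneg fun k _ => (hr k).le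
  refine ⟨(1 + ∑ k, (r k)⁻¹)⁻¹, by positivity, 1 + ∑ k, r k, by positivity, fun v => ⟨?_, ?_⟩⟩
  · rw [Finset.mul_sum]
    refine Finset.sum_le_sum fun k _ => mul_le_mul_of_nonneg_right ?_ (sq_nonneg _)
    refine inv_le_of_inv_le₀ (hr k) ?_
    have := Finset.single_le_sum (f := fun k => (r k)⁻¹)
      (fun k _ => (inv_pos.2 (hr k)).le) (Finset.mem_univ k)
    linarith
  · rw [Finset.mul_sum]
    refine Finset.sum_le_sum fun k _ => mul_le_mul_of_nonneg_right ?_ (sq_nonneg _)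
    have := Finset.single_le_sum (f := r) (fun k _ => (hr k).le) (Finset.mem_univ k)
    linarith

lemma dotProduct_neg_lyapunov_mulVec {ι : Type*} [Fintype ι] [DecidableEq ι]
    {lam : ι → ℝ} (hlam : ∀ k, 0 < lam k) (F : Matrix ι ι ℝ) (d : ι → ℝ) (μ : ℝ) (v : ι → ℝ) :
    v ⬝ᵥ ((-(((Matrix.diagonal lam)⁻¹ * F - μ • (1 : Matrix ι ι ℝ))ᵀ * Matrix.diagonal d
        + Matrix.diagonal d * ((Matrix.diagonal lam)⁻¹ * F - μ • (1 : Matrix ι ι ℝ)))) *ᵥ v)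
      = 2 * μ * ∑ k, d k * v k ^ 2 - ∑ k, 2 * (d k / lam k) * v k * (F *ᵥ v) k := by
  have hinv : (Matrix.diagonal lam)⁻¹ = Matrix.diagonal fun k => (lam k)⁻¹ := by
    apply Matrix.inv_eq_right_inv
    rw [Matrix.diagonal_mul_diagonal, ← Matrix.diagonal_one]
    congr 1
    ext k
    exact mul_inv_cancel₀ (hlam k).ne'
  rw [hinv]
  set A := Matrix.diagonal (fun k => (lam k)⁻¹) * F - μ • (1 : Matrix ι ι ℝ) with hA
  have hAv : ∀ k, (A *ᵥ v) k = (lam k)⁻¹ * (F *ᵥ v) k - μ * v k := fun k => by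
    rw [hA, Matrix.sub_mulVec, ← Matrix.mulVec_mulVec, Matrix.smul_mulVec, Matrix.one_mulVec]
    simp only [Pi.sub_apply, Matrix.mulVec_diagonal, Pi.smul_apply, smul_eq_mul]
  rw [Matrix.neg_mulVec, Matrix.add_mulVec, ← Matrix.mulVec_mulVec, ← Matrix.mulVec_mulVec,
    dotProduct_neg, dotProduct_add, Matrix.dotProduct_mulVec v Aᵀ, Matrix.vecMul_transpose]
  simp only [dotProduct, Matrix.mulVec_diagonal, hAv]
  rw [Finset.mul_sum, ← Finset.sum_sub_distrib, ← Finset.sum_add_distrib, ← Finset.sum_neg_distrib]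
  refine Finset.sum_congr rfl fun k _ => ?_
  ring

lemma exp_mul_sum_sq_mulVec_le {ι : Type*} [Fintype ι] [DecidableEq ι] {G : Matrix ι ι ℝ}
    {d : ι → ℝ} {c : ℝ} (h : matLE (c • (Gᵀ * Matrix.diagonal d * G)) (Matrix.diagonal d))
    (v : ι → ℝ) : c * ∑ k, d k * (G *ᵥ v) k ^ 2 ≤ ∑ k, d k * v k ^ 2 := by
  have h1 := Matrix.PosSemidef.dotProduct_mulVec_nonneg h v
  rw [star_trivial, Matrix.sub_mulVec, Matrix.smul_mulVec, dotProduct_sub, dotProduct_smul,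
    ← Matrix.mulVec_mulVec, ← Matrix.mulVec_mulVec, Matrix.dotProduct_mulVec v Gᵀ,
    Matrix.vecMul_transpose] at h1
  simp only [dotProduct, Matrix.mulVec_diagonal, smul_eq_mul, sub_nonneg] at h1
  calc _ = c * ∑ k, (G *ᵥ v) k * (d k * (G *ᵥ v) k) := by
        congr 1; exact Finset.sum_congr rfl fun k _ => by ring
    _ ≤ _ := h1
    _ = _ := Finset.sum_congr rfl fun k _ => by ring

lemma uniqueDiffOn_strip : UniqueDiffOn ℝ strip :=
  (uniqueDiffOn_Ici 0).prod (uniqueDiffOn_Icc one_pos)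

section Slices

variable {ι : Type*} [Fintype ι] {f : ℝ × ℝ → ι → ℝ}

lemma continuousOn_fderivWithin_strip_apply (hf : ContDiffOn ℝ 1 f strip) (e : ℝ × ℝ) (k : ι) :
    ContinuousOn (fun q => fderivWithin ℝ f strip q e k) strip :=
  continuousOn_pi.1 ((hf.continuousOn_fderivWithin uniqueDiffOn_strip le_rfl).clm_apply
    continuousOn_const) k

lemma hasDerivAt_time (hf : ContDiffOn ℝ 1 f strip) {t x : ℝ} (ht : 0 < t) (hx : x ∈ Icc (0:ℝ) 1)
    (k : ι) : HasDerivAt (fun s => f (s, x) k) (fderivWithin ℝ f strip (t, x) (1, 0) k) t := by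
  have h := ((hf.differentiableOn one_ne_zero) (t, x) ⟨ht.le, hx⟩).hasFDerivWithinAt
  have h2 := h.comp_hasDerivWithinAt (s := Ici 0) t
    ((hasDerivAt_id t).prodMk (hasDerivAt_const t x)).hasDerivWithinAt
    (fun s hs => (⟨hs, hx⟩ : (s, x) ∈ strip))
  exact hasDerivAt_pi.1 (h2.hasDerivAt (Ici_mem_nhds ht)) k

lemma hasDerivAt_space (hf : ContDiffOn ℝ 1 f strip) {t x : ℝ} (ht : 0 ≤ t)
    (hx : x ∈ Ioo (0:ℝ) 1) (k : ι) :
    HasDerivAt (fun s => f (t, s) k) (fderivWithin ℝ f strip (t, x) (0, 1) k) x := by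
  have h := ((hf.differentiableOn one_ne_zero) (t, x)
    ⟨ht, Ioo_subset_Icc_self hx⟩).hasFDerivWithinAt
  have h2 := h.comp_hasDerivWithinAt (s := Icc 0 1) x
    ((hasDerivAt_const x t).prodMk (hasDerivAt_id x)).hasDerivWithinAt
    (fun s hs => (⟨ht, hs⟩ : (t, s) ∈ strip))
  exact hasDerivAt_pi.1 (h2.hasDerivAt (Icc_mem_nhds hx.1 hx.2)) k

end Slices

/-- Corollary 2.2: if `yᵀ M y` (with `M` diagonal positive definite) is a common Lyapunov
function for the continuous-time system `ẏ = (Λ⁻¹F - μI)y` and the discrete-time system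
`y(t+1) = e^μ G y(t)`, then the hyperbolic system (with all characteristic velocities
positive, `m = 0`) is globally exponentially stable. -/
theorem stmt_3
    (n : ℕ) (hn : 1 ≤ n)
    (lam : Fin n → ℝ) (hlam : ∀ k, 0 < lam k)
    (F G : Matrix (Fin n) (Fin n) ℝ)
    (d : Fin n → ℝ) (hd : ∀ k, 0 < d k) (μ : ℝ)
    -- (Λ⁻¹F - μI)ᵀ M + M (Λ⁻¹F - μI) is negative definite
    (hcont : (-(((Matrix.diagonal lam)⁻¹ * F - μ • (1 : Matrix (Fin n) (Fin n) ℝ))ᵀ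
                  * Matrix.diagonal d
                + Matrix.diagonal d
                  * ((Matrix.diagonal lam)⁻¹ * F
                      - μ • (1 : Matrix (Fin n) (Fin n) ℝ)))).PosDef)
    -- e^{2μ} Gᵀ M G ≤ M
    (hdisc : matLE (Real.exp (2 * μ) • (Gᵀ * Matrix.diagonal d * G)) (Matrix.diagonal d)) :
    ∃ ν > (0:ℝ), ∃ C > (0:ℝ), ∀ y : ℝ → ℝ → Fin n → ℝ,
      -- `y` is C¹ on [0,∞) × [0,1]
      ContDiffOn ℝ 1 (fun q : ℝ × ℝ => y q.1 q.2) (Ici (0:ℝ) ×ˢ Icc (0:ℝ) 1) →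
      -- the hyperbolic PDE ∂ₜ y + Λ ∂ₓ y = F y
      (∀ t ∈ Ici (0:ℝ), ∀ x ∈ Icc (0:ℝ) 1,
        fderivWithin ℝ (fun q : ℝ × ℝ => y q.1 q.2) (Ici (0:ℝ) ×ˢ Icc (0:ℝ) 1) (t, x) (1, 0)
          + (Matrix.diagonal lam).mulVec
              (fderivWithin ℝ (fun q : ℝ × ℝ => y q.1 q.2)
                (Ici (0:ℝ) ×ˢ Icc (0:ℝ) 1) (t, x) (0, 1))
          = F.mulVec (y t x)) →
      -- the boundary condition y(t,0) = G y(t,1)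
      (∀ t ∈ Ici (0:ℝ), y t 0 = G.mulVec (y t 1)) →
      ∀ t ≥ (0:ℝ),
        Real.sqrt (∫ x in (0:ℝ)..1, ∑ k, (y t x k) ^ 2)
          ≤ C * Real.exp (-ν * t) * Real.sqrt (∫ x in (0:ℝ)..1, ∑ k, (y 0 x k) ^ 2) := by
  obtain ⟨c, hc, hP⟩ := exists_pos_mul_sum_sq_le hcont
  simp only [dotProduct_neg_lyapunov_mulVec hlam] at hP
  obtain ⟨a, ha, b, hb, hab⟩ := exists_sum_sq_bounds fun k => div_pos (hd k) (hlam k)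
  set K : ℝ := Real.exp (2 * |μ|) * b / (Real.exp (-(2 * |μ|)) * a) with hK
  have hK0 : 0 < K := by positivity
  refine ⟨c / b / 2, by positivity, √K, Real.sqrt_pos.2 hK0, fun y hy hpde hbc => ?_⟩
  have hfk : ∀ k, ContinuousOn (fun q : ℝ × ℝ => y q.1 q.2 k) strip :=
    continuousOn_pi.1 hy.continuousOn
  set D := fderivWithin ℝ (fun q : ℝ × ℝ => y q.1 q.2) strip with hD
  have hDk : ∀ e k, ContinuousOn (fun q => D q e k) strip :=
    fun e k => continuousOn_fderivWithin_strip_apply hy e k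
  let w : ℝ → ℝ := fun x => Real.exp (-(2 * μ) * x)
  have hw : Continuous w := by fun_prop
  have hw0 : ∀ x, 0 < w x := fun x => Real.exp_pos _
  have hwx : ∀ x ∈ Icc (0:ℝ) 1, |-(2 * μ) * x| ≤ 2 * |μ| := fun x hx => by
    rw [abs_mul, abs_neg, abs_mul, abs_two, abs_of_nonneg hx.1]
    exact mul_le_of_le_one_right (by positivity) hx.2
  have hwl : ∀ x ∈ Icc (0:ℝ) 1, Real.exp (-(2 * |μ|)) ≤ w x := fun x hx =>
    Real.exp_le_exp.2 (abs_le.1 (hwx x hx)).1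
  have hwu : ∀ x ∈ Icc (0:ℝ) 1, w x ≤ Real.exp (2 * |μ|) := fun x hx =>
    Real.exp_le_exp.2 (abs_le.1 (hwx x hx)).2
  let S : ℝ × ℝ → ℝ := fun q => ∑ k, y q.1 q.2 k ^ 2
  let g : ℝ × ℝ → ℝ := fun q => w q.2 * ∑ k, d k / lam k * y q.1 q.2 k ^ 2
  let g' : ℝ × ℝ → ℝ := fun q => w q.2 * ∑ k, 2 * (d k / lam k) * y q.1 q.2 k * D q (1, 0) k
  let h' : ℝ × ℝ → ℝ := fun q => w q.2 * (-(2 * μ) * ∑ k, d k * y q.1 q.2 k ^ 2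
    + ∑ k, 2 * d k * y q.1 q.2 k * D q (0, 1) k)
  have hw2 : ContinuousOn (fun q : ℝ × ℝ => w q.2) strip := by fun_prop
  have hS : ContinuousOn S strip := by fun_prop
  have hg : ContinuousOn g strip := by fun_prop
  have hg' : ContinuousOn g' strip :=
    hw2.mul (continuousOn_finsetSum _ fun k _ => (continuousOn_const.mul (hfk k)).mul (hDk _ k))
  have hh' : ContinuousOn h' strip :=
    hw2.mul (ContinuousOn.add (by fun_prop)
      (continuousOn_finsetSum _ fun k _ => (continuousOn_const.mul (hfk k)).mul (hDk _ k)))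
  have hgd : ∀ t > 0, ∀ x ∈ Icc (0:ℝ) 1, HasDerivAt (fun s => g (s, x)) (g' (t, x)) t := by
    intro t ht x hx
    refine (HasDerivAt.fun_sum (u := Finset.univ) fun k _ => ?_).const_mul (w x)
    refine (((hasDerivAt_time hy ht hx k).fun_pow 2).const_mul (d k / lam k)).congr_deriv ?_
    simp only [hD]
    ring
  have hhint : ∀ t ≥ 0, ∫ x in (0:ℝ)..1, h' (t, x) =
      w 1 * ∑ k, d k * y t 1 k ^ 2 - w 0 * ∑ k, d k * y t 0 k ^ 2 := by
    intro t ht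
    refine intervalIntegral.integral_eq_sub_of_hasDerivAt_of_le
      (f := fun x => w x * ∑ k, d k * y t x k ^ 2) zero_le_one ?_ (fun x hx => ?_)
      (intervalIntegrable_slice hh' ht)
    · exact continuousOn_slice (g := fun q => w q.2 * ∑ k, d k * y q.1 q.2 k ^ 2)
        (by fun_prop) ht
    · have h1 : HasDerivAt (fun x => ∑ k, d k * y t x k ^ 2)
          (∑ k, 2 * d k * y t x k * D (t, x) (0, 1) k) x := by
        refine HasDerivAt.fun_sum fun k _ => ?_
        refine (((hasDerivAt_space hy ht hx k).fun_pow 2).const_mul (d k)).congr_deriv ?_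
        simp only [hD]
        ring
      have h2 : HasDerivAt w (w x * -(2 * μ)) x := by
        simpa [w] using ((hasDerivAt_id x).const_mul (-(2 * μ))).exp
      refine (h2.fun_mul h1).congr_deriv ?_
      simp only [h']
      ring
  have hbdry : ∀ t ≥ 0, w 0 * ∑ k, d k * y t 0 k ^ 2 ≤ w 1 * ∑ k, d k * y t 1 k ^ 2 := by
    intro t ht
    have h1 := mul_le_mul_of_nonneg_left (exp_mul_sum_sq_mulVec_le hdisc (y t 1)) (hw0 1).le
    rw [← hbc t ht, ← mul_assoc] at h1
    have hw01 : w 1 * Real.exp (2 * μ) = w 0 := by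
      simp only [w]
      rw [← Real.exp_add]
      simp
    rwa [hw01] at h1
  have hpt : ∀ t ≥ 0, ∀ x ∈ Icc (0:ℝ) 1, g' (t, x) ≤ -h' (t, x) - c / b * g (t, x) := by
    intro t ht x hx
    have hk : ∀ k, D (t, x) (1, 0) k = (F *ᵥ y t x) k - lam k * D (t, x) (0, 1) k := fun k => by
      have h1 := congrFun (hpde t ht x hx) k
      rw [Pi.add_apply, Matrix.mulVec_diagonal] at h1
      exact eq_sub_of_add_eq h1
    have hsum : ∑ k, 2 * (d k / lam k) * y t x k * D (t, x) (1, 0) k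
        = ∑ k, 2 * (d k / lam k) * y t x k * (F *ᵥ y t x) k
          - ∑ k, 2 * d k * y t x k * D (t, x) (0, 1) k := by
      rw [← Finset.sum_sub_distrib]
      refine Finset.sum_congr rfl fun k _ => ?_
      rw [hk]
      have := (hlam k).ne'
      field_simp
    have hdec : c / b * ∑ k, d k / lam k * y t x k ^ 2 ≤ c * ∑ k, y t x k ^ 2 :=
      calc _ ≤ c / b * (b * ∑ k, y t x k ^ 2) := by gcongr; exact (hab _).2
        _ = _ := by field_simp
    have h2 := mul_le_mul_of_nonneg_left (hdec.trans (hP (y t x))) (hw0 x).le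
    simp only [g', h', g, hsum]
    linarith
  let W : ℝ → ℝ := fun t => ∫ x in (0:ℝ)..1, g (t, x)
  have hdiss : ∀ t > 0, ∫ x in (0:ℝ)..1, g' (t, x) ≤ -(c / b) * W t := by
    intro t ht
    have hih := intervalIntegrable_slice hh' ht.le
    have hig := intervalIntegrable_slice hg ht.le
    have h1 := intervalIntegral.integral_mono_on zero_le_one (intervalIntegrable_slice hg' ht.le)
      (hih.neg.sub (hig.const_mul (c / b))) (hpt t ht.le)
    rw [intervalIntegral.integral_sub hih.neg (hig.const_mul (c / b)),
      intervalIntegral.integral_const_mul] at h1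
    simp only [Pi.neg_apply, intervalIntegral.integral_neg] at h1
    rw [hhint t ht.le] at h1
    have := hbdry t ht.le
    simp only [W]
    linarith
  intro t ht
  have hdecay : W t ≤ Real.exp (-(c / b) * t) * W 0 :=
    le_exp_mul_of_hasDerivAt_le (continuousOn_integral_strip hg)
      (fun s hs => hasDerivAt_integral_strip hg hg' hgd hs) hdiss ht
  have hS0 : ∀ q, 0 ≤ S q := fun q => Finset.sum_nonneg fun k _ => sq_nonneg _
  have hlow : Real.exp (-(2 * |μ|)) * a * ∫ x in (0:ℝ)..1, S (t, x) ≤ W t := by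
    rw [← intervalIntegral.integral_const_mul]
    refine intervalIntegral.integral_mono_on zero_le_one
      ((intervalIntegrable_slice hS ht).const_mul _) (intervalIntegrable_slice hg ht) fun x hx => ?_
    rw [mul_assoc]
    exact mul_le_mul (hwl x hx) (hab _).1 (mul_nonneg ha.le (hS0 _)) (hw0 x).le
  have hup : W 0 ≤ Real.exp (2 * |μ|) * b * ∫ x in (0:ℝ)..1, S (0, x) := by
    rw [← intervalIntegral.integral_const_mul]
    refine intervalIntegral.integral_mono_on zero_le_one (intervalIntegrable_slice hg le_rfl)
      ((intervalIntegrable_slice hS le_rfl).const_mul _) fun x hx => ?_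
    rw [mul_assoc]
    exact mul_le_mul (hwu x hx) (hab _).2
      ((mul_nonneg ha.le (hS0 (0, x))).trans (hab _).1) (Real.exp_pos _).le
  have hmain : ∫ x in (0:ℝ)..1, S (t, x)
      ≤ K * Real.exp (-(c / b) * t) * ∫ x in (0:ℝ)..1, S (0, x) := by
    have h1 := hlow.trans (hdecay.trans (mul_le_mul_of_nonneg_left hup (Real.exp_pos _).le))
    rw [← le_div_iff₀' (by positivity)] at h1
    refine h1.trans_eq ?_
    rw [hK]
    ring
  have hexp : Real.exp (-(c / b) * t) = Real.exp (-(c / b / 2) * t) ^ 2 := by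
    rw [← Real.exp_nat_mul]
    congr 1
    push_cast
    ring
  calc √(∫ x in (0:ℝ)..1, S (t, x))
      ≤ √(K * Real.exp (-(c / b) * t) * ∫ x in (0:ℝ)..1, S (0, x)) := Real.sqrt_le_sqrt hmain
    _ = _ := by
      rw [Real.sqrt_mul (by positivity), Real.sqrt_mul hK0.le, hexp,
        Real.sqrt_sq (Real.exp_pos _).le]
end
end

section
/- Assume m_i = m for all i ∈ I, and that there exist ν > 0, γ ≥ 1, reals μ_i and diagonal positive definite matrices Q_i = diag[Q_i⁻, Q_i⁺] ∈ ℝ^{n×n} such that, setting 𝒬_i(x) = diag[e^{2μ_i x} Q_i⁻, e^{−2μ_i x} Q_i⁺], for every i ∈ I and x ∈ [0,1]: −2μ_i𝒬_i(x)Λ_i⁺ + F_iᵀ𝒬_i(x) + 𝒬_i(x)F_i ≤ −2ν𝒬_i(x), and E₀ᵢᵀ 𝒬_i(0) Λ_i E₀ᵢ ≤ E₁ᵢᵀ 𝒬_i(1) Λ_i E₁ᵢ where E₀ᵢ = [[I_m, 0],[G_{i+−}, G_{i++}]] and E₁ᵢ = [[G_{i−−}, G_{i−+}],[0, I_{n−m}]],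 together with (S_i⁺)ᵀQ_i⁺S_i⁺ ≤ γ(S_j⁺)ᵀQ_j⁺S_j⁺ and (S_i⁻)ᵀQ_i⁻S_i⁻ ≤ γ(S_j⁻)ᵀQ_j⁻S_j⁻ for all i,j ∈ I. Let Δμ = max_i μ_i − min_i μ_i. Then for every N₀ ∈ ℕ and every average dwell time τ_D > ln(γ)/(2ν) + Δμ/ν, the switched linear hyperbolic system is globally uniformly exponentially stable with respect to 𝒮_{τ_D,N₀}: there exist ν' > 0 and C > 0 such that for every σ ∈ 𝒮_{τ_D,N₀} and every classical solution w, ‖w(t,·)‖_{L²((0,1);ℝⁿ)} ≤ C e^{−ν't} ‖w(0,·)‖_{L²((0,1);ℝⁿ)} for all t ≥ 0. -/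
open Matrix Set Real

noncomputable section

open MeasureTheory

theorem hasFDerivAt_exp_mul_weight_mul_sq {ν : ℝ} {ρ : ℝ → ℝ} {ρ' : ℝ} {v : ℝ × ℝ → ℝ}
    {D : ℝ × ℝ →L[ℝ] ℝ} {p : ℝ × ℝ} (hρ : HasDerivAt ρ ρ' p.2) (hv : HasFDerivAt v D p) :
    HasFDerivAt (fun p : ℝ × ℝ => Real.exp (2 * ν * p.1) * (ρ p.2 * v p ^ 2))
      (Real.exp (2 * ν * p.1) •
        ((2 * ν * (ρ p.2 * v p ^ 2)) • ContinuousLinearMap.fst ℝ ℝ ℝ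
          + (ρ' * v p ^ 2) • ContinuousLinearMap.snd ℝ ℝ ℝ + (2 * ρ p.2 * v p) • D)) p := by
  have h1 : HasFDerivAt (fun p : ℝ × ℝ => Real.exp (2 * ν * p.1)) _ p :=
    ((hasFDerivAt_fst (𝕜 := ℝ) (p := p)).const_mul (2 * ν)).exp
  have h2 : HasFDerivAt (fun p : ℝ × ℝ => ρ p.2) _ p :=
    hρ.comp_hasFDerivAt p (hasFDerivAt_snd (𝕜 := ℝ) (p := p))
  refine (h1.mul (h2.mul (hv.pow 2))).congr_fderiv ?_
  ext <;> simp <;> ring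

/-- Exponential decay of a weighted quadratic energy for a diagonal hyperbolic system on a
space-time rectangle, obtained from the divergence theorem. -/
theorem diagonal_energy_le {ι : Type*} [Fintype ι] {a b ν : ℝ} (hab : a ≤ b) (lam : ι → ℝ)
    (F : Matrix ι ι ℝ) (ρ ρ' : ι → ℝ → ℝ) (hρ : ∀ k x, HasDerivAt (ρ k) (ρ' k x) x)
    (hρ' : ∀ k, Continuous (ρ' k)) (v : ι → ℝ × ℝ → ℝ) (D : ι → ℝ × ℝ → ℝ × ℝ →L[ℝ] ℝ)
    (hvc : ∀ k, ContinuousOn (v k) (Icc a b ×ˢ Icc (0 : ℝ) 1))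
    (hvd : ∀ k, ∀ p ∈ Ioo a b ×ˢ Ioo (0 : ℝ) 1, HasFDerivAt (v k) (D k p) p)
    (hpde : ∀ k, ∀ p ∈ Icc a b ×ˢ Icc (0 : ℝ) 1,
      D k p (1, 0) + lam k * D k p (0, 1) = (F *ᵥ fun l => v l p) k)
    (hdiss : ∀ x ∈ Icc (0 : ℝ) 1, ∀ u : ι → ℝ,
      ∑ k, (2 * ν * (ρ k x * u k ^ 2) + ρ' k x * lam k * u k ^ 2
        + 2 * ρ k x * u k * (F *ᵥ u) k) ≤ 0)
    (hbd : ∀ t ∈ Icc a b, ∑ k, ρ k 0 * lam k * v k (t, 0) ^ 2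
      ≤ ∑ k, ρ k 1 * lam k * v k (t, 1) ^ 2) :
    Real.exp (2 * ν * b) * ∫ x in (0 : ℝ)..1, ∑ k, ρ k x * v k (b, x) ^ 2
      ≤ Real.exp (2 * ν * a) * ∫ x in (0 : ℝ)..1, ∑ k, ρ k x * v k (a, x) ^ 2 := by
  have hIcc : Icc ((a, 0) : ℝ × ℝ) (b, 1) = Icc a b ×ˢ Icc (0 : ℝ) 1 := by
    rw [Icc_prod_eq]
  have hρc : ∀ k, Continuous (ρ k) := fun k =>
    continuous_iff_continuousAt.2 fun x => (hρ k x).continuousAt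
  have hval : ∀ p ∈ Icc ((a, 0) : ℝ × ℝ) (b, 1),
      (∑ k, Real.exp (2 * ν * p.1) •
        ((2 * ν * (ρ k p.2 * v k p ^ 2)) • ContinuousLinearMap.fst ℝ ℝ ℝ
          + (ρ' k p.2 * v k p ^ 2) • ContinuousLinearMap.snd ℝ ℝ ℝ
          + (2 * ρ k p.2 * v k p) • D k p)) (1, 0)
      + (∑ k, Real.exp (2 * ν * p.1) •
        ((2 * ν * (ρ k p.2 * lam k * v k p ^ 2)) • ContinuousLinearMap.fst ℝ ℝ ℝ
          + (ρ' k p.2 * lam k * v k p ^ 2) • ContinuousLinearMap.snd ℝ ℝ ℝ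
          + (2 * (ρ k p.2 * lam k) * v k p) • D k p)) (0, 1)
      = Real.exp (2 * ν * p.1) *
        ∑ k, (2 * ν * (ρ k p.2 * v k p ^ 2) + ρ' k p.2 * lam k * v k p ^ 2
          + 2 * ρ k p.2 * v k p * (F *ᵥ fun l => v l p) k) := by
    intro p hp
    rw [hIcc] at hp
    simp only [_root_.sum_apply, Finset.mul_sum, ← Finset.sum_add_distrib]
    refine Finset.sum_congr rfl fun k _ => ?_
    rw [← hpde k p hp]
    simp
    ring
  have key := integral_divergence_prod_Icc_of_hasFDerivAt_of_le
    (fun p : ℝ × ℝ => ∑ k, Real.exp (2 * ν * p.1) * (ρ k p.2 * v k p ^ 2))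
    (fun p : ℝ × ℝ => ∑ k, Real.exp (2 * ν * p.1) * (ρ k p.2 * lam k * v k p ^ 2))
    (fun p => ∑ k, Real.exp (2 * ν * p.1) •
        ((2 * ν * (ρ k p.2 * v k p ^ 2)) • ContinuousLinearMap.fst ℝ ℝ ℝ
          + (ρ' k p.2 * v k p ^ 2) • ContinuousLinearMap.snd ℝ ℝ ℝ
          + (2 * ρ k p.2 * v k p) • D k p))
    (fun p => ∑ k, Real.exp (2 * ν * p.1) •
        ((2 * ν * (ρ k p.2 * lam k * v k p ^ 2)) • ContinuousLinearMap.fst ℝ ℝ ℝ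
          + (ρ' k p.2 * lam k * v k p ^ 2) • ContinuousLinearMap.snd ℝ ℝ ℝ
          + (2 * (ρ k p.2 * lam k) * v k p) • D k p))
    (a, 0) (b, 1) ⟨hab, zero_le_one⟩ (by rw [hIcc]; fun_prop) (by rw [hIcc]; fun_prop)
    (fun p hp => HasFDerivAt.fun_sum fun k _ =>
      hasFDerivAt_exp_mul_weight_mul_sq (hρ k p.2) (hvd k p hp))
    (fun p hp => HasFDerivAt.fun_sum fun k _ =>
      hasFDerivAt_exp_mul_weight_mul_sq ((hρ k p.2).mul_const (lam k)) (hvd k p hp))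
    (by
      refine IntegrableOn.congr_fun (ContinuousOn.integrableOn_compact isCompact_Icc ?_)
        (fun p hp => (hval p hp).symm) measurableSet_Icc
      rw [hIcc]
      simp only [Matrix.mulVec, dotProduct]
      fun_prop)
  have hneg := setIntegral_nonpos (μ := volume) measurableSet_Icc
    (fun p hp => (hval p hp).trans_le <| mul_nonpos_of_nonneg_of_nonpos (Real.exp_pos _).le <|
      hdiss p.2 (by rw [hIcc] at hp; exact hp.2) fun l => v l p)
  have hslice : ∀ x ∈ Icc (0 : ℝ) 1, ∀ k, ContinuousOn (fun t => v k (t, x)) (Icc a b) :=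
    fun x hx k => (hvc k).comp (by fun_prop) fun t ht => ⟨ht, hx⟩
  have hbdry : (∫ t in a..b, ∑ k, Real.exp (2 * ν * t) * (ρ k 0 * lam k * v k (t, 0) ^ 2))
      ≤ ∫ t in a..b, ∑ k, Real.exp (2 * ν * t) * (ρ k 1 * lam k * v k (t, 1) ^ 2) := by
    have h0 := hslice 0 (by simp)
    have h1 := hslice 1 (by simp)
    refine intervalIntegral.integral_mono_on hab ?_ ?_ fun t ht => ?_
    · refine ContinuousOn.intervalIntegrable ?_
      rw [uIcc_of_le hab]
      exact continuousOn_finsetSum _ fun k _ => ContinuousOn.mul (by fun_prop)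
        (continuousOn_const.mul ((h0 k).pow 2))
    · refine ContinuousOn.intervalIntegrable ?_
      rw [uIcc_of_le hab]
      exact continuousOn_finsetSum _ fun k _ => ContinuousOn.mul (by fun_prop)
        (continuousOn_const.mul ((h1 k).pow 2))
    · rw [← Finset.mul_sum, ← Finset.mul_sum]
      exact mul_le_mul_of_nonneg_left (hbd t ht) (Real.exp_pos _).le
  rw [key] at hneg
  simp only [← Finset.mul_sum, intervalIntegral.integral_const_mul] at hneg hbdry
  linarith

theorem switched_energy_le {I : Type*} {E : I → ℝ → ℝ} {sig : ℝ → I} {times : Set ℝ} {K c : ℝ}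
    (hK : 0 ≤ K) (hfin : ∀ T : ℝ, (times ∩ Icc 0 T).Finite)
    (hconst : ∀ s t : ℝ, 0 ≤ s → s ≤ t → (∀ u, s < u → u ≤ t → u ∉ times) → sig t = sig s)
    (hdecay : ∀ a b : ℝ, 0 ≤ a → a < b → (∀ u, a < u → u < b → u ∉ times) →
      Real.exp (c * b) * E (sig a) b ≤ Real.exp (c * a) * E (sig a) a)
    (hjump : ∀ i j t, 0 ≤ t → E j t ≤ K * E i t) (N : ℕ) :
    ∀ t : ℝ, 0 ≤ t → (times ∩ Ioc 0 t).ncard = N →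
      Real.exp (c * t) * E (sig t) t ≤ K ^ N * E (sig 0) 0 := by
  have hfin' : ∀ t : ℝ, (times ∩ Ioc 0 t).Finite := fun t =>
    (hfin t).subset (inter_subset_inter_right _ Ioc_subset_Icc_self)
  have hstep : ∀ s t : ℝ, 0 ≤ s → s ≤ t → (∀ u, s < u → u ≤ t → u ∉ times) →
      Real.exp (c * t) * E (sig t) t ≤ Real.exp (c * s) * E (sig s) s := by
    intro s t hs hst hu
    rcases hst.eq_or_lt with rfl | hlt
    · exact le_rfl
    · rw [hconst s t hs hst hu]
      exact hdecay s t hs hlt fun u h1 h2 => hu u h1 h2.le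
  induction N with
  | zero =>
    intro t ht hN
    rw [Set.ncard_eq_zero (hfin' t)] at hN
    have := hstep 0 t le_rfl ht fun u h1 h2 h3 =>
      (hN ▸ (⟨h3, h1, h2⟩ : u ∈ times ∩ Ioc 0 t) : u ∈ (∅ : Set ℝ))
    simpa using this
  | succ N ih =>
    intro t ht hN
    have hne : (times ∩ Ioc 0 t).Nonempty := Set.nonempty_of_ncard_ne_zero (by omega)
    obtain ⟨s, ⟨hst, hs0, hs1⟩, hmax⟩ := Set.exists_max_image _ id (hfin' t) hne
    obtain ⟨M, hM, hMmax⟩ := Set.exists_max_image (insert 0 ((times ∩ Ioc 0 s) \ {s})) id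
      (((hfin' s).sdiff).insert 0) (Set.insert_nonempty _ _)
    have hM0 : 0 ≤ M := hMmax 0 (mem_insert _ _)
    have hMs : M < s := by
      rcases hM with rfl | ⟨⟨_, _, h⟩, h'⟩
      · exact hs0
      · exact lt_of_le_of_ne h h'
    have hfree : ∀ u, M < u → u < s → u ∉ times := fun u h1 h2 h3 =>
      absurd (hMmax u (Or.inr ⟨⟨h3, hM0.trans_lt h1, h2.le⟩, h2.ne⟩)) (not_le.2 h1)
    have hcard : (times ∩ Ioc 0 ((M + s) / 2)).ncard = N := by
      have hins : times ∩ Ioc 0 t = insert s (times ∩ Ioc 0 ((M + s) / 2)) := by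
        ext u
        constructor
        · rintro ⟨h1, h2, h3⟩
          have hus : u ≤ s := hmax u ⟨h1, h2, h3⟩
          rcases hus.eq_or_lt with rfl | hlt
          · exact Or.inl rfl
          · refine Or.inr ⟨h1, h2, ?_⟩
            have : u ≤ M := not_lt.1 fun h => hfree u h hlt h1
            linarith
        · rintro (rfl | ⟨h1, h2, h3⟩)
          · exact ⟨hst, hs0, hs1⟩
          · exact ⟨h1, h2, by linarith⟩
      rw [hins, Set.ncard_insert_of_notMem (fun h => by linarith [h.2.2]) (hfin' _)] at hN
      omega
    calc Real.exp (c * t) * E (sig t) t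
        ≤ Real.exp (c * s) * E (sig s) s := hstep s t hs0.le hs1 fun u h1 h2 h3 =>
          absurd (hmax u ⟨h3, hs0.trans h1, h2⟩) (not_le.2 h1)
      _ ≤ Real.exp (c * s) * (K * E (sig ((M + s) / 2)) s) :=
          mul_le_mul_of_nonneg_left (hjump _ _ _ hs0.le) (Real.exp_pos _).le
      _ = K * (Real.exp (c * s) * E (sig ((M + s) / 2)) s) := by ring
      _ ≤ K * (Real.exp (c * ((M + s) / 2)) * E (sig ((M + s) / 2)) ((M + s) / 2)) :=
          mul_le_mul_of_nonneg_left (hdecay _ _ (by linarith) (by linarith)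
            fun u h1 h2 => hfree u (by linarith) h2) hK
      _ ≤ K * (K ^ N * E (sig 0) 0) :=
          mul_le_mul_of_nonneg_left (ih _ (by linarith) hcard) hK
      _ = K ^ (N + 1) * E (sig 0) 0 := by ring

theorem exists_sum_sq_mulVec_le {ι : Type*} [Fintype ι] (M : Matrix ι ι ℝ) :
    ∃ C > (0 : ℝ), ∀ v : ι → ℝ, ∑ k, (M *ᵥ v) k ^ 2 ≤ C * ∑ k, v k ^ 2 := by
  refine ⟨(∑ k, ∑ l, M k l ^ 2) + 1, by positivity, fun v => ?_⟩
  have h : ∑ k, (M *ᵥ v) k ^ 2 ≤ (∑ k, ∑ l, M k l ^ 2) * ∑ k, v k ^ 2 := by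
    rw [Finset.sum_mul]
    exact Finset.sum_le_sum fun k _ => Finset.sum_mul_sq_le_sq_mul_sq _ _ _
  have : 0 ≤ ∑ k, v k ^ 2 := by positivity
  linarith

theorem dotProduct_transpose_mul_diagonal_mul_mulVec {ι : Type*} [Fintype ι] [DecidableEq ι]
    (P R : Matrix ι ι ℝ) (d u : ι → ℝ) :
    u ⬝ᵥ ((Pᵀ * Matrix.diagonal d * R) *ᵥ u) = ∑ k, d k * (P *ᵥ u) k * (R *ᵥ u) k := by
  rw [← Matrix.mulVec_mulVec, ← Matrix.mulVec_mulVec, Matrix.dotProduct_mulVec,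
    Matrix.vecMul_transpose]
  simp only [dotProduct, Matrix.mulVec_diagonal]
  exact Finset.sum_congr rfl fun k _ => by ring

theorem matLE.dotProduct_mulVec_le_s6 {ι : Type*} [Fintype ι] {P R : Matrix ι ι ℝ}
    (h : matLE P R) (u : ι → ℝ) : u ⬝ᵥ (P *ᵥ u) ≤ u ⬝ᵥ (R *ᵥ u) := by
  have := Matrix.PosSemidef.dotProduct_mulVec_nonneg h u
  rw [star_trivial, Matrix.sub_mulVec, dotProduct_sub] at this
  linarith

/-- The diagonal entries of the weight matrix `diag[e^{2μx} Q⁻, e^{-2μx} Q⁺]`. -/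
def lyapunovWeight {n : ℕ} (m : ℕ) (μ : ℝ) (q : Fin n → ℝ) (k : Fin n) (x : ℝ) : ℝ :=
  if (k : ℕ) < m then Real.exp (2 * μ * x) * q k else Real.exp (-(2 * μ * x)) * q k

/-- The derivative of `lyapunovWeight` in the space variable. -/
def lyapunovWeightDeriv {n : ℕ} (m : ℕ) (μ : ℝ) (q : Fin n → ℝ) (k : Fin n) (x : ℝ) : ℝ :=
  if (k : ℕ) < m then 2 * μ * (Real.exp (2 * μ * x) * q k)
  else -(2 * μ) * (Real.exp (-(2 * μ * x)) * q k)

section Weight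

variable {n : ℕ} (m : ℕ) (μ : ℝ) (q : Fin n → ℝ) (k : Fin n) (x : ℝ)

theorem hasDerivAt_lyapunovWeight :
    HasDerivAt (lyapunovWeight m μ q k) (lyapunovWeightDeriv m μ q k x) x := by
  unfold lyapunovWeight lyapunovWeightDeriv
  split_ifs
  · refine ((((hasDerivAt_id x).const_mul (2 * μ)).exp).mul_const (q k)).congr_deriv ?_
    simp; ring
  · refine (((((hasDerivAt_id x).const_mul (2 * μ)).neg).exp).mul_const (q k)).congr_deriv ?_
    simp; ring

theorem continuous_lyapunovWeight : Continuous (lyapunovWeight m μ q k) :=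
  continuous_iff_continuousAt.2 fun x => (hasDerivAt_lyapunovWeight m μ q k x).continuousAt

theorem continuous_lyapunovWeightDeriv : Continuous (lyapunovWeightDeriv m μ q k) := by
  unfold lyapunovWeightDeriv
  split_ifs <;> fun_prop

theorem lyapunovWeightDeriv_mul {lam : Fin n → ℝ}
    (hlam : ∀ k : Fin n, if (k : ℕ) < m then lam k < 0 else 0 < lam k) :
    lyapunovWeightDeriv m μ q k x * lam k = -(2 * μ) * (lyapunovWeight m μ q k x * |lam k|) := by
  have h := hlam k
  unfold lyapunovWeight lyapunovWeightDeriv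
  split_ifs at h ⊢
  · rw [abs_of_neg h]; ring
  · rw [abs_of_pos h]; ring

variable {q k x}

theorem lyapunovWeight_bounds (hq : 0 < q k) (hx : x ∈ Icc (0 : ℝ) 1) :
    q k ≤ Real.exp (2 * |μ|) * lyapunovWeight m μ q k x ∧
      lyapunovWeight m μ q k x ≤ Real.exp (2 * |μ|) * q k := by
  have hμx : |μ * x| ≤ |μ| := by
    rw [abs_mul, abs_of_nonneg hx.1]
    exact mul_le_of_le_one_right (abs_nonneg _) hx.2
  obtain ⟨h1, h2⟩ := abs_le.1 hμx
  unfold lyapunovWeight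
  split_ifs
  all_goals
    rw [← mul_assoc, ← Real.exp_add]
    exact ⟨le_mul_of_one_le_left hq.le (Real.one_le_exp (by linarith)),
      mul_le_mul_of_nonneg_right (Real.exp_le_exp.2 (by linarith)) hq.le⟩

theorem lyapunovWeight_nonneg (hq : 0 < q k) : 0 ≤ lyapunovWeight m μ q k x := by
  unfold lyapunovWeight
  split_ifs <;> positivity

end Weight

theorem exists_weighted_sum_sq_bounds {n : ℕ} (m : ℕ) (μ : ℝ) {q : Fin n → ℝ} (hq : ∀ k, 0 < q k)
    {S : Matrix (Fin n) (Fin n) ℝ} (hS : IsUnit S) :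
    ∃ C > (0 : ℝ), ∀ x ∈ Icc (0 : ℝ) 1, ∀ v : Fin n → ℝ,
      ∑ k, v k ^ 2 ≤ C * ∑ k, lyapunovWeight m μ q k x * (S *ᵥ v) k ^ 2 ∧
      ∑ k, lyapunovWeight m μ q k x * (S *ᵥ v) k ^ 2 ≤ C * ∑ k, v k ^ 2 := by
  obtain ⟨C₁, hC₁, h₁⟩ := exists_sum_sq_mulVec_le S
  obtain ⟨C₂, hC₂, h₂⟩ := exists_sum_sq_mulVec_le S⁻¹
  have hinv : S⁻¹ * S = 1 := Matrix.nonsing_inv_mul S ((Matrix.isUnit_iff_isUnit_det S).1 hS)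
  have hq' : ∀ k, 0 < (q k)⁻¹ := fun k => inv_pos.2 (hq k)
  set e := Real.exp (2 * |μ|)
  have he : 0 < e := Real.exp_pos _
  have hQ : 0 ≤ ∑ k, q k := Finset.sum_nonneg fun k _ => (hq k).le
  have hQ' : 0 ≤ ∑ k, (q k)⁻¹ := Finset.sum_nonneg fun k _ => (hq' k).le
  refine ⟨e * (∑ k, q k) * C₁ + C₂ * (e * ∑ k, (q k)⁻¹) + 1, by positivity, fun x hx v => ?_⟩
  have hv : 0 ≤ ∑ k, v k ^ 2 := by positivity
  have hE : 0 ≤ ∑ k, lyapunovWeight m μ q k x * (S *ᵥ v) k ^ 2 :=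
    Finset.sum_nonneg fun k _ => mul_nonneg (lyapunovWeight_nonneg m μ (hq k)) (sq_nonneg _)
  constructor
  · have hlow : ∑ k, (S *ᵥ v) k ^ 2
        ≤ (e * ∑ k, (q k)⁻¹) * ∑ k, lyapunovWeight m μ q k x * (S *ᵥ v) k ^ 2 := by
      rw [Finset.mul_sum]
      refine Finset.sum_le_sum fun k _ => ?_
      rw [← mul_assoc]
      refine le_mul_of_one_le_left (sq_nonneg _) ?_
      have hk : (q k)⁻¹ ≤ ∑ k, (q k)⁻¹ :=
        Finset.single_le_sum (fun k _ => (hq' k).le) (Finset.mem_univ k)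
      calc (1 : ℝ) = (q k)⁻¹ * q k := (inv_mul_cancel₀ (hq k).ne').symm
        _ ≤ (∑ k, (q k)⁻¹) * (e * lyapunovWeight m μ q k x) :=
          mul_le_mul hk (lyapunovWeight_bounds m μ (hq k) hx).1 (hq k).le hQ'
        _ = _ := by ring
    have h := h₂ (S *ᵥ v)
    rw [Matrix.mulVec_mulVec, hinv, Matrix.one_mulVec] at h
    have h' := mul_le_mul_of_nonneg_left hlow hC₂.le
    have : 0 ≤ e * (∑ k, q k) * C₁ * ∑ k, lyapunovWeight m μ q k x * (S *ᵥ v) k ^ 2 := by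
      positivity
    linarith
  · have hup : ∑ k, lyapunovWeight m μ q k x * (S *ᵥ v) k ^ 2
        ≤ (e * ∑ k, q k) * ∑ k, (S *ᵥ v) k ^ 2 := by
      rw [Finset.mul_sum]
      refine Finset.sum_le_sum fun k _ => mul_le_mul_of_nonneg_right ?_ (sq_nonneg _)
      exact (lyapunovWeight_bounds m μ (hq k) hx).2.trans <| mul_le_mul_of_nonneg_left
        (Finset.single_le_sum (fun k _ => (hq k).le) (Finset.mem_univ k)) he.le
    have h' := mul_le_mul_of_nonneg_left (h₁ v) (mul_nonneg he.le hQ)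
    have : 0 ≤ C₂ * (e * ∑ k, (q k)⁻¹) * ∑ k, v k ^ 2 := by positivity
    linarith

/-- Comparison of the weighted quadratic forms of two modes. -/
theorem weighted_sum_sq_le {n : ℕ} (m : ℕ) {μ₁ μ₂ δ γ : ℝ} {q₁ q₂ : Fin n → ℝ}
    (hq₁ : ∀ k, 0 < q₁ k) (hγ : 0 ≤ γ) (hδ : |μ₂ - μ₁| ≤ δ)
    {S₁ S₂ : Matrix (Fin n) (Fin n) ℝ}
    (hneg : matLE (S₂ᵀ * Matrix.diagonal (fun k : Fin n => if (k : ℕ) < m then q₂ k else 0) * S₂)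
      (γ • (S₁ᵀ * Matrix.diagonal (fun k : Fin n => if (k : ℕ) < m then q₁ k else 0) * S₁)))
    (hpos : matLE (S₂ᵀ * Matrix.diagonal (fun k : Fin n => if (k : ℕ) < m then 0 else q₂ k) * S₂)
      (γ • (S₁ᵀ * Matrix.diagonal (fun k : Fin n => if (k : ℕ) < m then 0 else q₁ k) * S₁)))
    {x : ℝ} (hx : x ∈ Icc (0 : ℝ) 1) (v : Fin n → ℝ) :
    ∑ k, lyapunovWeight m μ₂ q₂ k x * (S₂ *ᵥ v) k ^ 2
      ≤ γ * Real.exp (2 * δ) * ∑ k, lyapunovWeight m μ₁ q₁ k x * (S₁ *ᵥ v) k ^ 2 := by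
  have hsplit : ∀ (μ : ℝ) (q : Fin n → ℝ) (S : Matrix (Fin n) (Fin n) ℝ),
      ∑ k, lyapunovWeight m μ q k x * (S *ᵥ v) k ^ 2
        = Real.exp (2 * μ * x) * (∑ k : Fin n, (if (k : ℕ) < m then q k else 0) * (S *ᵥ v) k ^ 2)
          + Real.exp (-(2 * μ * x)) *
            (∑ k : Fin n, (if (k : ℕ) < m then 0 else q k) * (S *ᵥ v) k ^ 2) := by
    intro μ q S
    rw [Finset.mul_sum, Finset.mul_sum, ← Finset.sum_add_distrib]
    refine Finset.sum_congr rfl fun k _ => ?_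
    unfold lyapunovWeight
    split_ifs <;> ring
  have h1 := hneg.dotProduct_mulVec_le_s6 v
  have h2 := hpos.dotProduct_mulVec_le_s6 v
  simp only [Matrix.smul_mulVec, dotProduct_smul, smul_eq_mul,
    dotProduct_transpose_mul_diagonal_mul_mulVec] at h1 h2
  simp only [mul_assoc, ← pow_two] at h1 h2
  have hδx : |(μ₂ - μ₁) * x| ≤ δ := by
    rw [abs_mul, abs_of_nonneg hx.1]
    exact (mul_le_of_le_one_right (abs_nonneg _) hx.2).trans hδ
  obtain ⟨h3, h4⟩ := abs_le.1 hδx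
  have e1 : Real.exp (2 * μ₂ * x) ≤ Real.exp (2 * δ) * Real.exp (2 * μ₁ * x) := by
    rw [← Real.exp_add]
    exact Real.exp_le_exp.2 (by linarith)
  have e2 : Real.exp (-(2 * μ₂ * x)) ≤ Real.exp (2 * δ) * Real.exp (-(2 * μ₁ * x)) := by
    rw [← Real.exp_add]
    exact Real.exp_le_exp.2 (by linarith)
  have p1 : 0 ≤ ∑ k : Fin n, (if (k : ℕ) < m then q₁ k else 0) * (S₁ *ᵥ v) k ^ 2 :=
    Finset.sum_nonneg fun k _ => mul_nonneg (by split_ifs <;> simp [(hq₁ k).le]) (sq_nonneg _)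
  have p2 : 0 ≤ ∑ k : Fin n, (if (k : ℕ) < m then 0 else q₁ k) * (S₁ *ᵥ v) k ^ 2 :=
    Finset.sum_nonneg fun k _ => mul_nonneg (by split_ifs <;> simp [(hq₁ k).le]) (sq_nonneg _)
  rw [hsplit, hsplit]
  calc _ ≤ Real.exp (2 * μ₂ * x) * (γ * _) + Real.exp (-(2 * μ₂ * x)) * (γ * _) :=
        add_le_add (mul_le_mul_of_nonneg_left h1 (Real.exp_pos _).le)
          (mul_le_mul_of_nonneg_left h2 (Real.exp_pos _).le)
    _ ≤ Real.exp (2 * δ) * Real.exp (2 * μ₁ * x) * (γ * _)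
          + Real.exp (2 * δ) * Real.exp (-(2 * μ₁ * x)) * (γ * _) :=
        add_le_add (mul_le_mul_of_nonneg_right e1 (mul_nonneg hγ p1))
          (mul_le_mul_of_nonneg_right e2 (mul_nonneg hγ p2))
    _ = _ := by ring

/-- The boundary conditions solved for the outgoing characteristic components. -/
theorem eq_mulVec_of_boundary_condition {n : ℕ} (m : ℕ) (G : Matrix (Fin n) (Fin n) ℝ) {u₀ u₁ : Fin n → ℝ}
    (h : (Matrix.of fun k l : Fin n =>
          if (l : ℕ) < m then -(G k l) else if k = l then (1 : ℝ) else 0) *ᵥ u₀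
        + (Matrix.of fun k l : Fin n =>
          if (l : ℕ) < m then (if k = l then (1 : ℝ) else 0) else -(G k l)) *ᵥ u₁ = 0) :
    u₀ = (Matrix.of fun k l : Fin n =>
        if (k : ℕ) < m then (if k = l then (1 : ℝ) else 0) else G k l) *ᵥ
          (fun l => if (l : ℕ) < m then u₀ l else u₁ l) ∧
    u₁ = (Matrix.of fun k l : Fin n =>
        if (k : ℕ) < m then G k l else if k = l then (1 : ℝ) else 0) *ᵥ
          (fun l => if (l : ℕ) < m then u₀ l else u₁ l) := by
  have hG : ∀ k : Fin n, ∑ l, G k l * (if (l : ℕ) < m then u₀ l else u₁ l)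
      = if (k : ℕ) < m then u₁ k else u₀ k := by
    intro k
    have hk := congrFun h k
    simp only [Pi.add_apply, Matrix.mulVec, dotProduct, Matrix.of_apply, Pi.zero_apply,
      ← Finset.sum_add_distrib] at hk
    have hsum : (if (k : ℕ) < m then u₁ k else u₀ k)
        = ∑ l, if k = l then (if (l : ℕ) < m then u₁ l else u₀ l) else 0 := by
      rw [Finset.sum_ite_eq]
      simp
    refine sub_eq_zero.1 (neg_eq_zero.1 (Eq.trans ?_ hk))
    rw [hsum, ← Finset.sum_sub_distrib, ← Finset.sum_neg_distrib]
    refine Finset.sum_congr rfl fun l _ => ?_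
    split_ifs <;> ring
  set z : Fin n → ℝ := fun l => if (l : ℕ) < m then u₀ l else u₁ l
  have hzk : ∀ k : Fin n, z k = if (k : ℕ) < m then u₀ k else u₁ k := fun k => rfl
  simp only [← hzk] at hG
  clear_value z
  constructor
  all_goals
    ext k
    have h₁ := hG k
    have h₂ := hzk k
    by_cases hk : (k : ℕ) < m
    all_goals
      simp only [Matrix.mulVec, dotProduct, Matrix.of_apply, hk, if_true, if_false] at h₁ h₂ ⊢
      simp [h₁, h₂]

/-- The Lyapunov functional of one mode decays exponentially between switching times. -/
theorem mode_energy_le {n : ℕ} (m : ℕ) {S A L F G B0 B1 E0 E1 : Matrix (Fin n) (Fin n) ℝ}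
    (hS : IsUnit S) {lam : Fin n → ℝ}
    (hlam : ∀ k : Fin n, if (k : ℕ) < m then lam k < 0 else 0 < lam k)
    (hL : L = S⁻¹ * Matrix.diagonal lam * S) (hF : F = S * A * S⁻¹)
    (hB0 : B0 = (Matrix.of fun k l : Fin n =>
        if (l : ℕ) < m then -(G k l) else if k = l then (1 : ℝ) else 0) * S)
    (hB1 : B1 = (Matrix.of fun k l : Fin n =>
        if (l : ℕ) < m then (if k = l then (1 : ℝ) else 0) else -(G k l)) * S)
    {ν μ : ℝ} {q : Fin n → ℝ} {Qx : ℝ → Matrix (Fin n) (Fin n) ℝ}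
    (hQx : ∀ x, Qx x = Matrix.diagonal (fun k => lyapunovWeight m μ q k x))
    (hE0 : E0 = Matrix.of fun k l : Fin n =>
        if (k : ℕ) < m then (if k = l then (1 : ℝ) else 0) else G k l)
    (hE1 : E1 = Matrix.of fun k l : Fin n =>
        if (k : ℕ) < m then G k l else if k = l then (1 : ℝ) else 0)
    (hlmi1 : ∀ x ∈ Icc (0 : ℝ) 1,
      matLE (-(2 * μ) • (Qx x * Matrix.diagonal (fun k => |lam k|)) + Fᵀ * Qx x + Qx x * F)
        (-(2 * ν) • Qx x))
    (hlmi2 : matLE (E0ᵀ * (Qx 0 * Matrix.diagonal lam) * E0)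
      (E1ᵀ * (Qx 1 * Matrix.diagonal lam) * E1))
    {a b : ℝ} (hab : a < b) {w : ℝ → ℝ → Fin n → ℝ}
    (hw : ContDiffOn ℝ 1 (fun pt : ℝ × ℝ => w pt.1 pt.2) (Icc a b ×ˢ Icc (0 : ℝ) 1))
    (hpde : ∀ t ∈ Icc a b, ∀ x ∈ Icc (0 : ℝ) 1,
      fderivWithin ℝ (fun pt : ℝ × ℝ => w pt.1 pt.2) (Icc a b ×ˢ Icc (0 : ℝ) 1) (t, x) (1, 0)
        + L *ᵥ fderivWithin ℝ (fun pt : ℝ × ℝ => w pt.1 pt.2)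
            (Icc a b ×ˢ Icc (0 : ℝ) 1) (t, x) (0, 1) = A *ᵥ w t x)
    (hbc : ∀ t ∈ Icc a b, B0 *ᵥ w t 0 + B1 *ᵥ w t 1 = 0) :
    Real.exp (2 * ν * b) * ∫ x in (0 : ℝ)..1, ∑ k, lyapunovWeight m μ q k x * (S *ᵥ w b x) k ^ 2
      ≤ Real.exp (2 * ν * a) *
        ∫ x in (0 : ℝ)..1, ∑ k, lyapunovWeight m μ q k x * (S *ᵥ w a x) k ^ 2 := by
  have hinv : S⁻¹ * S = 1 := Matrix.nonsing_inv_mul S ((Matrix.isUnit_iff_isUnit_det S).1 hS)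
  have hinv' : S * S⁻¹ = 1 := Matrix.mul_nonsing_inv S ((Matrix.isUnit_iff_isUnit_det S).1 hS)
  have hSL : S * L = Matrix.diagonal lam * S := by
    rw [hL, ← mul_assoc, ← mul_assoc, hinv', one_mul]
  have hSA : S * A = F * S := by
    rw [hF, mul_assoc, hinv, mul_one]
  set W : ℝ × ℝ → Fin n → ℝ := fun pt => w pt.1 pt.2
  set R := Icc a b ×ˢ Icc (0 : ℝ) 1
  let T : Fin n → (Fin n → ℝ) →L[ℝ] ℝ := fun k =>
    ContinuousLinearMap.proj k ∘L S.mulVecLin.toContinuousLinearMap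
  refine diagonal_energy_le hab.le lam F (lyapunovWeight m μ q) (lyapunovWeightDeriv m μ q)
    (hasDerivAt_lyapunovWeight m μ q) (continuous_lyapunovWeightDeriv m μ q)
    (fun k p => T k (W p)) (fun k p => T k ∘L fderivWithin ℝ W R p)
    (fun k => (T k).continuous.comp_continuousOn hw.continuousOn) ?_ ?_ ?_ ?_
  · rintro k p ⟨hp1, hp2⟩
    have hR : R ∈ nhds p := prod_mem_nhds (Icc_mem_nhds hp1.1 hp1.2) (Icc_mem_nhds hp2.1 hp2.2)
    have hd : DifferentiableAt ℝ W p :=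
      (hw.differentiableOn one_ne_zero).differentiableAt hR
    rw [fderivWithin_of_mem_nhds hR]
    exact (T k).hasFDerivAt.comp p hd.hasFDerivAt
  · rintro k ⟨t, x⟩ ⟨ht, hx⟩
    have h := congrFun (congrArg (fun u => S *ᵥ u) (hpde t ht x hx)) k
    simp only [Matrix.mulVec_add, Matrix.mulVec_mulVec, hSL, hSA] at h
    rw [← Matrix.mulVec_mulVec, ← Matrix.mulVec_mulVec, Pi.add_apply,
      Matrix.mulVec_diagonal] at h
    exact h
  · intro x hx u
    have h := (hlmi1 x hx).dotProduct_mulVec_le_s6 u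
    have e1 := dotProduct_transpose_mul_diagonal_mul_mulVec F 1
      (fun k => lyapunovWeight m μ q k x) u
    have e2 := dotProduct_transpose_mul_diagonal_mul_mulVec 1 F
      (fun k => lyapunovWeight m μ q k x) u
    have e3 := dotProduct_transpose_mul_diagonal_mul_mulVec 1 1
      (fun k => lyapunovWeight m μ q k x) u
    have e4 := dotProduct_transpose_mul_diagonal_mul_mulVec 1 1
      (fun k => lyapunovWeight m μ q k x * |lam k|) u
    simp only [Matrix.transpose_one, one_mul, mul_one, Matrix.one_mulVec] at e1 e2 e3 e4
    rw [hQx, Matrix.diagonal_mul_diagonal] at h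
    simp only [Matrix.add_mulVec, Matrix.smul_mulVec, dotProduct_add, dotProduct_smul,
      smul_eq_mul, e1, e2, e3, e4, Finset.mul_sum, ← Finset.sum_add_distrib] at h
    rw [← sub_nonpos, ← Finset.sum_sub_distrib] at h
    refine le_of_eq_of_le (Finset.sum_congr rfl fun k _ => ?_) h
    rw [lyapunovWeightDeriv_mul m μ q k x hlam]
    ring
  · intro t ht
    have hbc' := hbc t ht
    rw [hB0, hB1, ← Matrix.mulVec_mulVec, ← Matrix.mulVec_mulVec] at hbc'
    obtain ⟨h0, h1⟩ := eq_mulVec_of_boundary_condition m G hbc'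
    rw [← hE0] at h0
    rw [← hE1] at h1
    have h := hlmi2.dotProduct_mulVec_le_s6
      (fun l => if (l : ℕ) < m then (S *ᵥ w t 0) l else (S *ᵥ w t 1) l)
    rw [hQx, hQx, Matrix.diagonal_mul_diagonal, Matrix.diagonal_mul_diagonal,
      dotProduct_transpose_mul_diagonal_mul_mulVec, dotProduct_transpose_mul_diagonal_mul_mulVec,
      ← h0, ← h1] at h
    simp only [mul_assoc, ← pow_two] at h
    simp only [mul_assoc]
    exact h

/-- Average dwell time turns the jump-decay estimate into uniform exponential decay. -/
theorem pow_mul_exp_le_of_dwell {κ ν τ t : ℝ} {N N₀ : ℕ} (hκ : 0 ≤ κ)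
    (hN : (N : ℝ) ≤ N₀ + t / τ) :
    Real.exp κ ^ N * Real.exp (-(2 * ν * t))
      ≤ Real.exp (κ * N₀) * Real.exp (-(ν - κ / (2 * τ)) * t) ^ 2 := by
  rw [← Real.exp_nat_mul, ← Real.exp_nat_mul, ← Real.exp_add, ← Real.exp_add]
  refine Real.exp_le_exp.2 ?_
  have h := mul_le_mul_of_nonneg_left hN hκ
  have h2 : κ / (2 * τ) * 2 = κ / τ := by
    rw [mul_comm 2 τ, ← div_div, div_mul_cancel₀ _ two_ne_zero]
  have h3 : κ * (N₀ + t / τ) = κ * N₀ + κ / τ * t := by ring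
  rw [h3, ← h2] at h
  push_cast
  linarith

/-- Theorem (mode independent sign structure, average dwell time):
under the mode-wise Lyapunov matrix inequalities with comparison constant γ, the switched
linear hyperbolic system is globally uniformly exponentially stable with respect to the
class 𝒮_{τ_D,N₀} of switching signals with chatter bound N₀ and average dwell time
τ_D > ln(γ)/(2ν) + Δμ/ν.
A switching signal is encoded by its values `sig : ℝ → I` together with its set `times`
of switching times (its discontinuities), and a classical solution is a continuous
function which is C¹ and satisfies the PDE and boundary conditions of the active mode
on every interval free of switching times. -/
theorem stmt_6
    (n : ℕ) (hn : 1 ≤ n) (I : Type) [Fintype I] [Nonempty I]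
    (m : ℕ) (hm : m ≤ n)
    (S : I → Matrix (Fin n) (Fin n) ℝ) (hS : ∀ i, IsUnit (S i))
    (lam : I → Fin n → ℝ)
    (hlam : ∀ i (k : Fin n), if (k : ℕ) < m then lam i k < 0 else 0 < lam i k)
    (A L F : I → Matrix (Fin n) (Fin n) ℝ)
    (hL : ∀ i, L i = (S i)⁻¹ * Matrix.diagonal (lam i) * S i)
    (hF : ∀ i, F i = S i * A i * (S i)⁻¹)
    (G : I → Matrix (Fin n) (Fin n) ℝ)
    (B0 B1 : I → Matrix (Fin n) (Fin n) ℝ)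
    -- B⁰ᵢ = [[-Gᵢ₋₋, 0],[-Gᵢ₊₋, I]] Sᵢ  and  B¹ᵢ = [[I, -Gᵢ₋₊],[0, -Gᵢ₊₊]] Sᵢ
    (hB0 : ∀ i, B0 i = (Matrix.of fun k l : Fin n =>
        if (l : ℕ) < m then -(G i k l) else if k = l then (1:ℝ) else 0) * S i)
    (hB1 : ∀ i, B1 i = (Matrix.of fun k l : Fin n =>
        if (l : ℕ) < m then (if k = l then (1:ℝ) else 0) else -(G i k l)) * S i)
    (ν γ : ℝ) (hν : 0 < ν) (hγ : 1 ≤ γ) (μ : I → ℝ)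
    (q : I → Fin n → ℝ) (hq : ∀ i k, 0 < q i k)
    -- 𝒬ᵢ(x) = diag[e^{2μx} Qᵢ⁻, e^{-2μx} Qᵢ⁺]
    (Qx : I → ℝ → Matrix (Fin n) (Fin n) ℝ)
    (hQx : ∀ i x, Qx i x = Matrix.diagonal (fun k : Fin n =>
        if (k : ℕ) < m then Real.exp (2 * μ i * x) * q i k
        else Real.exp (-(2 * μ i * x)) * q i k))
    -- E₀ᵢ = [[I, 0],[Gᵢ₊₋, Gᵢ₊₊]],  E₁ᵢ = [[Gᵢ₋₋, Gᵢ₋₊],[0, I]]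
    (E0 E1 : I → Matrix (Fin n) (Fin n) ℝ)
    (hE0 : ∀ i, E0 i = Matrix.of fun k l : Fin n =>
        if (k : ℕ) < m then (if k = l then (1:ℝ) else 0) else G i k l)
    (hE1 : ∀ i, E1 i = Matrix.of fun k l : Fin n =>
        if (k : ℕ) < m then G i k l else if k = l then (1:ℝ) else 0)
    (hlmi1 : ∀ i, ∀ x ∈ Icc (0:ℝ) 1,
      matLE (-(2 * μ i) • (Qx i x * Matrix.diagonal (fun k => |lam i k|))
              + (F i)ᵀ * Qx i x + Qx i x * F i)
            (-(2 * ν) • Qx i x))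
    (hlmi2 : ∀ i,
      matLE ((E0 i)ᵀ * (Qx i 0 * Matrix.diagonal (lam i)) * E0 i)
            ((E1 i)ᵀ * (Qx i 1 * Matrix.diagonal (lam i)) * E1 i))
    -- (Sᵢ⁻)ᵀ Qᵢ⁻ Sᵢ⁻ ≤ γ (Sⱼ⁻)ᵀ Qⱼ⁻ Sⱼ⁻ and (Sᵢ⁺)ᵀ Qᵢ⁺ Sᵢ⁺ ≤ γ (Sⱼ⁺)ᵀ Qⱼ⁺ Sⱼ⁺
    (hleqm : ∀ i j,
      matLE ((S i)ᵀ * Matrix.diagonal (fun k : Fin n => if (k : ℕ) < m then q i k else 0) * S i)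
        (γ • ((S j)ᵀ * Matrix.diagonal (fun k : Fin n => if (k : ℕ) < m then q j k else 0) * S j)))
    (hleqp : ∀ i j,
      matLE ((S i)ᵀ * Matrix.diagonal (fun k : Fin n => if (k : ℕ) < m then 0 else q i k) * S i)
        (γ • ((S j)ᵀ * Matrix.diagonal (fun k : Fin n => if (k : ℕ) < m then 0 else q j k) * S j))) :
    -- Δμ = max μᵢ - min μᵢ
    ∀ (N₀ : ℕ) (τD : ℝ),
      Real.log γ / (2 * ν)
          + (Finset.univ.sup' Finset.univ_nonempty μ
              - Finset.univ.inf' Finset.univ_nonempty μ) / ν < τD →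
    ∃ ν' > (0:ℝ), ∃ C > (0:ℝ),
      ∀ (sig : ℝ → I) (times : Set ℝ),
        -- switching times are positive and locally finite
        (∀ t ∈ times, 0 < t) →
        (∀ T : ℝ, (times ∩ Icc 0 T).Finite) →
        -- `sig` is constant (hence right-continuous) between switching times
        (∀ s t : ℝ, 0 ≤ s → s ≤ t → (∀ u, s < u → u ≤ t → u ∉ times) → sig t = sig s) →
        -- switching times are genuine discontinuities of `sig`
        (∀ t ∈ times, ∀ ε > (0:ℝ), ∃ s, t - ε < s ∧ s < t ∧ sig s ≠ sig t) →
        -- average dwell time condition: N_σ(τ,t) ≤ N₀ + (t-τ)/τD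
        (∀ τ t : ℝ, 0 ≤ τ → τ < t →
          ((times ∩ Ioc τ t).ncard : ℝ) ≤ (N₀ : ℝ) + (t - τ) / τD) →
        ∀ w : ℝ → ℝ → Fin n → ℝ,
          -- `w` is continuous on [0,∞) × [0,1]
          ContinuousOn (fun pt : ℝ × ℝ => w pt.1 pt.2) (Ici (0:ℝ) ×ˢ Icc (0:ℝ) 1) →
          -- on every interval free of switching times, `w` is C¹ and satisfies the PDE
          -- and the boundary conditions of the active mode
          (∀ a b : ℝ, 0 ≤ a → a < b → (∀ u, a < u → u < b → u ∉ times) →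
            ContDiffOn ℝ 1 (fun pt : ℝ × ℝ => w pt.1 pt.2) (Icc a b ×ˢ Icc (0:ℝ) 1) ∧
            (∀ t ∈ Icc a b, ∀ x ∈ Icc (0:ℝ) 1,
              fderivWithin ℝ (fun pt : ℝ × ℝ => w pt.1 pt.2)
                  (Icc a b ×ˢ Icc (0:ℝ) 1) (t, x) (1, 0)
                + (L (sig a)).mulVec
                    (fderivWithin ℝ (fun pt : ℝ × ℝ => w pt.1 pt.2)
                      (Icc a b ×ˢ Icc (0:ℝ) 1) (t, x) (0, 1))
                = (A (sig a)).mulVec (w t x)) ∧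
            (∀ t ∈ Icc a b,
              (B0 (sig a)).mulVec (w t 0) + (B1 (sig a)).mulVec (w t 1) = 0)) →
          ∀ t ≥ (0:ℝ),
            Real.sqrt (∫ x in (0:ℝ)..1, ∑ k, (w t x k) ^ 2)
              ≤ C * Real.exp (-ν' * t) * Real.sqrt (∫ x in (0:ℝ)..1, ∑ k, (w 0 x k) ^ 2) := by
  intro N₀ τD hτ
  set Δ := Finset.univ.sup' Finset.univ_nonempty μ - Finset.univ.inf' Finset.univ_nonempty μ
  have hΔ : ∀ i j, |μ j - μ i| ≤ Δ := by
    intro i j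
    have h1 := Finset.le_sup' μ (Finset.mem_univ i)
    have h2 := Finset.le_sup' μ (Finset.mem_univ j)
    have h3 := Finset.inf'_le μ (Finset.mem_univ i)
    have h4 := Finset.inf'_le μ (Finset.mem_univ j)
    exact abs_le.2 ⟨by linarith, by linarith⟩
  have hΔ0 : 0 ≤ Δ := (abs_nonneg _).trans (hΔ (Classical.arbitrary I) (Classical.arbitrary I))
  have hlog : 0 ≤ Real.log γ := Real.log_nonneg hγ
  set κ := Real.log γ + 2 * Δ
  have hκ : 0 ≤ κ := by positivity
  have hexpκ : Real.exp κ = γ * Real.exp (2 * Δ) := by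
    rw [Real.exp_add, Real.exp_log (by linarith)]
  have hτκ : κ / (2 * ν) < τD := by
    refine lt_of_eq_of_lt ?_ hτ
    simp only [κ]
    field_simp
  have hτ0 : 0 < τD := lt_of_le_of_lt (by positivity) hτκ
  have hν' : 0 < ν - κ / (2 * τD) := by
    rw [div_lt_iff₀ (by positivity)] at hτκ
    rw [sub_pos, div_lt_iff₀ (by positivity)]
    linarith
  have hbounds := fun i => exists_weighted_sum_sq_bounds m (μ i) (hq i) (hS i)
  choose c hc0 hc using hbounds
  obtain ⟨C, hC0, hC⟩ : ∃ C > (0 : ℝ), ∀ i, c i ≤ C :=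
    ⟨∑ i, c i, Finset.sum_pos (fun i _ => hc0 i) Finset.univ_nonempty,
      fun i => Finset.single_le_sum (fun i _ => (hc0 i).le) (Finset.mem_univ i)⟩
  refine ⟨ν - κ / (2 * τD), hν', Real.sqrt (C * C * Real.exp (κ * N₀)), by positivity, ?_⟩
  intro sig times _ hfin hconst _ hdwell w hw hsol t ht
  have hslice : ∀ s : ℝ, 0 ≤ s → ContinuousOn (fun x => w s x) (Icc 0 1) := fun s hs =>
    hw.comp (f := fun x : ℝ => (s, x)) (by fun_prop) fun x hx => ⟨hs, hx⟩
  have hnormint : ∀ s : ℝ, 0 ≤ s →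
      IntervalIntegrable (fun x => ∑ k, w s x k ^ 2) MeasureTheory.volume 0 1 := by
    intro s hs
    have := hslice s hs
    refine ContinuousOn.intervalIntegrable ?_
    rw [uIcc_of_le zero_le_one]
    fun_prop
  have hEint : ∀ i, ∀ s : ℝ, 0 ≤ s → IntervalIntegrable
      (fun x => ∑ k, lyapunovWeight m (μ i) (q i) k x * (S i *ᵥ w s x) k ^ 2)
      MeasureTheory.volume 0 1 := by
    intro i s hs
    have h1 := hslice s hs
    have h2 := continuous_lyapunovWeight m (μ i) (q i)
    refine ContinuousOn.intervalIntegrable ?_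
    rw [uIcc_of_le zero_le_one]
    simp only [Matrix.mulVec, dotProduct]
    fun_prop
  set E : I → ℝ → ℝ := fun i s =>
    ∫ x in (0 : ℝ)..1, ∑ k, lyapunovWeight m (μ i) (q i) k x * (S i *ᵥ w s x) k ^ 2 with hE
  have hlower : ∀ i, ∀ s : ℝ, 0 ≤ s →
      (∫ x in (0 : ℝ)..1, ∑ k, w s x k ^ 2) ≤ C * E i s := by
    intro i s hs
    rw [hE, ← intervalIntegral.integral_const_mul]
    refine intervalIntegral.integral_mono_on zero_le_one (hnormint s hs)
      ((hEint i s hs).const_mul C) fun x hx => ((hc i x hx (w s x)).1.trans ?_)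
    exact mul_le_mul_of_nonneg_right (hC i) <| Finset.sum_nonneg fun k _ =>
      mul_nonneg (lyapunovWeight_nonneg m (μ i) (hq i k)) (sq_nonneg _)
  have hupper : ∀ i, ∀ s : ℝ, 0 ≤ s →
      E i s ≤ C * ∫ x in (0 : ℝ)..1, ∑ k, w s x k ^ 2 := by
    intro i s hs
    rw [hE, ← intervalIntegral.integral_const_mul]
    refine intervalIntegral.integral_mono_on zero_le_one (hEint i s hs)
      ((hnormint s hs).const_mul C) fun x hx => ((hc i x hx (w s x)).2.trans ?_)
    exact mul_le_mul_of_nonneg_right (hC i) (by positivity)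
  have hjump : ∀ i j, ∀ s : ℝ, 0 ≤ s → E j s ≤ Real.exp κ * E i s := by
    intro i j s hs
    rw [hE, hexpκ, ← intervalIntegral.integral_const_mul]
    exact intervalIntegral.integral_mono_on zero_le_one (hEint j s hs)
      ((hEint i s hs).const_mul _) fun x hx =>
        weighted_sum_sq_le m (hq i) (by linarith) (hΔ i j) (hleqm j i) (hleqp j i) hx (w s x)
  have hdecay : ∀ a b : ℝ, 0 ≤ a → a < b → (∀ u, a < u → u < b → u ∉ times) →
      Real.exp (2 * ν * b) * E (sig a) b ≤ Real.exp (2 * ν * a) * E (sig a) a := by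
    intro a b ha hab hfree
    obtain ⟨h1, h2, h3⟩ := hsol a b ha hab hfree
    exact mode_energy_le m (hS _) (hlam _) (hL _) (hF _) (hB0 _) (hB1 _) (hQx _) (hE0 _) (hE1 _)
      (hlmi1 _) (hlmi2 _) hab h1 h2 h3
  have hmain := switched_energy_le (Real.exp_pos κ).le hfin hconst hdecay hjump _ t ht rfl
  set N := (times ∩ Ioc 0 t).ncard
  have hN : (N : ℝ) ≤ N₀ + t / τD := by
    rcases ht.eq_or_lt with rfl | ht'
    · simp [N]
    · simpa using hdwell 0 t le_rfl ht'
  have hrate := pow_mul_exp_le_of_dwell (ν := ν) hκ hN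
  set X := ∫ x in (0 : ℝ)..1, ∑ k, w 0 x k ^ 2
  have hX : 0 ≤ X := intervalIntegral.integral_nonneg zero_le_one fun x _ => by positivity
  have hEt : E (sig t) t = Real.exp (-(2 * ν * t)) * (Real.exp (2 * ν * t) * E (sig t) t) := by
    rw [← mul_assoc, ← Real.exp_add, neg_add_cancel, Real.exp_zero, one_mul]
  have hfinal : (∫ x in (0 : ℝ)..1, ∑ k, w t x k ^ 2)
      ≤ C * C * Real.exp (κ * N₀) * Real.exp (-(ν - κ / (2 * τD)) * t) ^ 2 * X :=
    calc (∫ x in (0 : ℝ)..1, ∑ k, w t x k ^ 2)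
        ≤ C * E (sig t) t := hlower _ t ht
      _ ≤ C * (Real.exp (-(2 * ν * t)) * (Real.exp κ ^ N * (C * X))) := by
          rw [hEt]
          have := hmain.trans
            (mul_le_mul_of_nonneg_left (hupper (sig 0) 0 le_rfl) (by positivity))
          gcongr
      _ = C * C * X * (Real.exp κ ^ N * Real.exp (-(2 * ν * t))) := by ring
      _ ≤ C * C * X * (Real.exp (κ * N₀) * Real.exp (-(ν - κ / (2 * τD)) * t) ^ 2) :=
          mul_le_mul_of_nonneg_left hrate (by positivity)
      _ = _ := by ring
  calc Real.sqrt (∫ x in (0 : ℝ)..1, ∑ k, w t x k ^ 2)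
      ≤ Real.sqrt (C * C * Real.exp (κ * N₀) * Real.exp (-(ν - κ / (2 * τD)) * t) ^ 2 * X) :=
        Real.sqrt_le_sqrt hfinal
    _ = _ := by
        rw [Real.sqrt_mul (by positivity), Real.sqrt_mul (by positivity),
          Real.sqrt_sq (Real.exp_pos _).le]
end
end
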